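/- arXiv:2406.10192 — 4 statements merged into one kernel-verified Lean document; each statement's English description precedes it below -/
import Mathlib

section
/- For every connected simple graph G, the edge set of G can be partitioned into at most 4 classes such that each class induces a subgraph in which every non-isolated vertex has odd degree (i.e., the odd chromatic index of G is at most 4). -/
open Finset

/-- A set has zero or odd cardinality. -/
def Set.ZeroOrOddCard {α : Type*} (s : Set α) : Prop :=
  s.ncard = 0 ∨ Odd s.ncard

lemma Set.Subsingleton.zeroOrOddCard {α : Type*} {s : Set α} (hs : s.Subsingleton) :
    s.ZeroOrOddCard := by
  obtain rfl | ⟨x, rfl⟩ := hs.eq_empty_or_singleton <;> simp [Set.ZeroOrOddCard]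

lemma exists_subset_zeroOrOddCard_diff_subset_singleton {α : Type*} [Finite α] [Nonempty α]
    (s : Set α) :
    ∃ t ⊆ s, t.ZeroOrOddCard ∧ ∃ a, s \ t ⊆ {a} := by
  by_cases h : s.ZeroOrOddCard
  · exact ⟨s, subset_rfl, h, Classical.arbitrary α, by simp⟩
  · simp only [Set.ZeroOrOddCard, not_or, Nat.not_odd_iff_even] at h
    obtain ⟨a, ha⟩ := Set.nonempty_of_ncard_ne_zero h.1
    refine ⟨s \ {a}, Set.sdiff_subset, Or.inr ?_, a, by grind⟩
    have := Set.ncard_sdiff_singleton_add_one ha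
    rw [← this, Nat.even_add_one] at h
    exact Nat.not_even_iff_odd.1 h.2

lemma sum_single_sym2 {V : Type*} [Fintype V] [DecidableEq V] {u v : V} (huv : u ≠ v) (x : V) :
    ∑ w, (Pi.single s(u, v) 1 : Sym2 V → ZMod 2) s(x, w)
      = (if x = u then 1 else 0) + (if x = v then 1 else 0) := by
  by_cases hxu : x = u
  · subst hxu
    simp [Pi.single_apply, huv]
  · by_cases hxv : x = v
    · subst hxv
      simp [Pi.single_apply, huv.symm]
    · simp [hxu, hxv]

lemma exists_chain_of_reachable {V : Type*} [Fintype V] [DecidableEq V] {G : SimpleGraph V}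
    {u v : V} (h : G.Reachable u v) :
    ∃ c : Sym2 V → ZMod 2, (∀ e ∉ G.edgeSet, c e = 0) ∧
      ∀ x, ∑ w, c s(x, w) = (if x = u then 1 else 0) + (if x = v then 1 else 0) := by
  obtain ⟨p⟩ := h
  induction p with
  | nil => exact ⟨0, by simp, fun x => by simp [CharTwo.add_self_eq_zero]⟩
  | @cons u w v huw p ih =>
    obtain ⟨c, hc, hb⟩ := ih
    refine ⟨c + Pi.single s(u, w) 1, fun e he => ?_, fun x => ?_⟩
    · have : e ≠ s(u, w) := fun h => he (h ▸ huw)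
      simp [hc e he, this]
    · simp only [Pi.add_apply, Finset.sum_add_distrib, hb, sum_single_sym2 huw.ne]
      have := CharTwo.add_self_eq_zero (if x = w then 1 else 0 : ZMod 2)
      linear_combination this

lemma exists_chain_boundary_eq {V : Type*} [Fintype V] [DecidableEq V] {G : SimpleGraph V}
    {S : Finset V} (hS : Even S.card) (hr : ∀ u ∈ S, ∀ v ∈ S, G.Reachable u v) :
    ∃ c : Sym2 V → ZMod 2, (∀ e ∉ G.edgeSet, c e = 0) ∧
      ∀ x, ∑ w, c s(x, w) = if x ∈ S then 1 else 0 := by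
  obtain rfl | ⟨r, hrS⟩ := S.eq_empty_or_nonempty
  · exact ⟨0, by simp⟩
  have h (u : S) := exists_chain_of_reachable (hr u u.2 r hrS)
  choose c hc hb using h
  refine ⟨∑ u, c u, fun e he => by simp [hc _ e he], fun x => ?_⟩
  simp only [Finset.sum_apply]
  rw [Finset.sum_comm]
  simp only [hb, Finset.sum_add_distrib]
  have h0 : (S.card : ZMod 2) = 0 := (ZMod.natCast_eq_zero_iff_even).2 hS
  rw [Finset.sum_coe_sort S (fun u => if x = u then (1 : ZMod 2) else 0)]
  simp [h0]

/-- If `S` is an even set of mutually reachable vertices, a maximal subgraph having odd degree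
exactly at the vertices of `S` has acyclic complement. -/
lemma exists_odd_subgraph_isAcyclic_sdiff {V : Type*} [Fintype V] {G : SimpleGraph V}
    {S : Finset V} (hS : Even S.card) (hr : ∀ u ∈ S, ∀ v ∈ S, G.Reachable u v) :
    ∃ H ≤ G, (G \ H).IsAcyclic ∧ ∀ x ∈ S, Odd (H.neighborSet x).ncard := by
  classical
  obtain ⟨c, ⟨hc, hb⟩, hmax⟩ := Set.exists_max_image
    {c : Sym2 V → ZMod 2 | (∀ e ∉ G.edgeSet, c e = 0) ∧
      ∀ x, ∑ w, c s(x, w) = if x ∈ S then 1 else 0}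
    (fun c => #{e | c e ≠ 0}) (Set.toFinite _) (exists_chain_boundary_eq hS hr)
  let H : SimpleGraph V :=
    { Adj x y := c s(x, y) ≠ 0
      symm := ⟨fun x y h => by rwa [Sym2.eq_swap]⟩
      loopless := ⟨fun x h => h (hc _ (by simp))⟩ }
  refine ⟨H, fun x y h => by_contra fun h' => h (hc _ h'), ?_, fun x hx => ?_⟩
  · rw [SimpleGraph.isAcyclic_iff_forall_adj_isBridge]
    intro u v huv
    rw [SimpleGraph.isBridge_iff]
    intro hreach
    obtain ⟨d, hd, hdb⟩ := exists_chain_of_reachable hreach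
    have hcuv : c s(u, v) = 0 := by
      have := huv.2
      simpa [H] using this
    have hduv : d s(u, v) = 0 := hd _ (by simp)
    have hd0 (e : Sym2 V) (he : c e ≠ 0) : d e = 0 := by
      induction e with
      | h x y =>
        refine hd _ fun h => ?_
        have h2 : (G \ H).Adj x y := SimpleGraph.deleteEdges_le _ h
        exact h2.2 he
    have hdG (e : Sym2 V) (he : e ∉ G.edgeSet) : d e = 0 := by
      induction e with
      | h x y =>
        refine hd _ fun h => ?_
        have h2 : (G \ H).Adj x y := SimpleGraph.deleteEdges_le _ h
        exact he h2.1
    have hle := hmax (c + d + Pi.single s(u, v) 1) ⟨fun e he => ?_, fun x => ?_⟩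
    · refine hle.not_gt (Finset.card_lt_card ?_)
      rw [Finset.ssubset_iff_of_subset]
      · exact ⟨s(u, v), by simp [hcuv, hduv]⟩
      · intro e he
        simp only [Finset.mem_filter, Finset.mem_univ, true_and] at he ⊢
        have : e ≠ s(u, v) := fun h => he (h ▸ hcuv)
        simp [this, hd0 e he, he]
    · have : e ≠ s(u, v) := fun h => he (h ▸ huv.1)
      simp [hc e he, hdG e he, this]
    · simp only [Pi.add_apply, Finset.sum_add_distrib, hb, hdb, sum_single_sym2 huv.ne]
      rw [add_assoc, CharTwo.add_self_eq_zero, add_zero]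
  · have hsum := hb x
    rw [if_pos hx] at hsum
    rw [← ZMod.natCast_eq_one_iff_odd, ← hsum, Set.ncard_eq_toFinset_card',
      Finset.card_eq_sum_ones, Nat.cast_sum, ← Finset.sum_subset (Finset.subset_univ _)]
    · refine Finset.sum_congr rfl fun w hw => ?_
      have hw' : c s(x, w) ≠ 0 := by simpa [H] using hw
      exact Nat.cast_one.trans (Fin.eq_one_of_ne_zero _ hw').symm
    · intro w _ hw
      simpa [H] using hw

lemma exists_potential_of_isAcyclic {V : Type*} [Fintype V] {F : SimpleGraph V}
    (hF : F.IsAcyclic) (y : Sym2 V → ZMod 2) :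
    ∃ a : V → ZMod 2, ∀ u v, F.Adj u v → a u + a v = y s(u, v) := by
  classical
  obtain ⟨a, -, hmin⟩ := Set.exists_min_image (Set.univ : Set (V → ZMod 2))
    (fun a => #{p : V × V | F.Adj p.1 p.2 ∧ a p.1 + a p.2 ≠ y s(p.1, p.2)})
    (Set.toFinite _) Set.univ_nonempty
  refine ⟨a, fun u v huv => by_contra fun hne => ?_⟩
  have hbr := SimpleGraph.isBridge_iff.1 (SimpleGraph.isAcyclic_iff_forall_adj_isBridge.1 hF huv)
  let R : V → Prop := (F.deleteEdges {s(u, v)}).Reachable u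
  have hRu : R u := .rfl
  have hR (x z : V) (hxz : F.Adj x z) (hne : s(x, z) ≠ s(u, v)) : R x ↔ R z := by
    have h : (F.deleteEdges {s(u, v)}).Adj x z := by simp [hxz, hne]
    exact ⟨fun h' => h'.trans h.reachable, fun h' => h'.trans h.symm.reachable⟩
  have hkey (x z : V) (hxz : F.Adj x z) (hne : s(x, z) ≠ s(u, v)) :
      (a x + if R x then 1 else 0) + (a z + if R z then 1 else 0) = a x + a z := by
    rw [if_congr (hR x z hxz hne) rfl rfl]
    linear_combination CharTwo.add_self_eq_zero (if R z then 1 else 0 : ZMod 2)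
  have hfix : (a u + if R u then 1 else 0) + (a v + if R v then 1 else 0) = y s(u, v) := by
    rw [if_pos hRu, if_neg hbr]
    generalize a u = p, a v = q, y s(u, v) = r at hne
    revert p q r
    decide
  refine (hmin (fun w => a w + if R w then 1 else 0) (Set.mem_univ _)).not_gt
    (Finset.card_lt_card ?_)
  rw [Finset.ssubset_iff_of_subset]
  · exact ⟨(u, v), by simp [huv, hne], by simp [hfix]⟩
  · rintro ⟨x, z⟩ h
    simp only [Finset.mem_filter, Finset.mem_univ, true_and] at h ⊢
    refine ⟨h.1, ?_⟩
    by_cases he : s(x, z) = s(u, v)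
    · refine absurd ?_ h.2
      rw [he, ← hfix]
      rcases Sym2.eq_iff.1 he with ⟨rfl, rfl⟩ | ⟨rfl, rfl⟩
      · rfl
      · exact add_comm _ _
    · rw [← hkey x z h.1 he]
      exact h.2

/-- A graph in which every `ZMod 2`-valued 1-cochain is a coboundary has an odd 2-edge-coloring. -/
lemma exists_odd_two_coloring {V : Type*} [Finite V] {F : SimpleGraph V}
    (hF : ∀ y : Sym2 V → ZMod 2, ∃ a : V → ZMod 2, ∀ u v, F.Adj u v → a u + a v = y s(u, v)) :
    ∃ b : Sym2 V → ZMod 2, ∀ v j, {w | F.Adj v w ∧ b s(v, w) = j}.ZeroOrOddCard := by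
  classical
  have h (v : V) : ∃ x : V → ZMod 2, ∀ j, {w | F.Adj v w ∧ x w = j}.ZeroOrOddCard := by
    have : Nonempty V := ⟨v⟩
    obtain ⟨t, ht, hodd, z, hz⟩ :=
      exists_subset_zeroOrOddCard_diff_subset_singleton (F.neighborSet v)
    refine ⟨fun w => if w ∈ t then 0 else 1, fun j => ?_⟩
    by_cases hj : j = 0
    · convert hodd using 1
      ext w
      have := @ht w
      simp_all
    · refine (Set.subsingleton_singleton (a := z)).anti (fun w hw => hz ⟨hw.1, fun hwt => hj ?_⟩)
        |>.zeroOrOddCard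
      exact hw.2.symm.trans (if_pos hwt)
  choose x hx using h
  obtain ⟨a, ha⟩ := hF (Sym2.lift ⟨fun v w => x v w + x w v, fun v w => add_comm _ _⟩)
  refine ⟨Sym2.lift ⟨fun v w => if F.Adj v w then x v w + a v else 0, fun v w => ?_⟩,
    fun v j => ?_⟩
  · by_cases hvw : F.Adj v w
    · have := ha v w hvw
      rw [Sym2.lift_mk] at this
      simp only [hvw, hvw.symm, if_true]
      dsimp only at this
      linear_combination this + CharTwo.add_self_eq_zero (x v w) -
        CharTwo.add_self_eq_zero (a w)
    · have hwv : ¬F.Adj w v := fun h => hvw h.symm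
      simp [hvw, hwv]
  · convert hx v (j - a v) using 1
    ext w
    simp +contextual [eq_sub_iff_add_eq]

lemma exists_odd_four_coloring_of_decomposition {V : Type*} [Finite V] {G H K : SimpleGraph V}
    (hH : H ≤ G) (hK : K ≤ G) (hHK : Disjoint H K)
    (hHodd : ∀ v, (H.neighborSet v).ZeroOrOddCard) (hKodd : ∀ v, (K.neighborSet v).ZeroOrOddCard)
    (hF : ∀ y : Sym2 V → ZMod 2, ∃ a : V → ZMod 2,
      ∀ u v, (G \ (H ⊔ K)).Adj u v → a u + a v = y s(u, v)) :
    ∃ φ : Sym2 V → Fin 4, ∀ v j, {w | G.Adj v w ∧ φ s(v, w) = j}.ZeroOrOddCard := by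
  classical
  obtain ⟨b, hb⟩ := exists_odd_two_coloring hF
  refine ⟨fun e => if e ∈ H.edgeSet then 2 else if e ∈ K.edgeSet then 3 else
    if b e = 0 then 0 else 1, fun v j => ?_⟩
  have hd (w : V) (h1 : H.Adj v w) (h2 : K.Adj v w) : False :=
    SimpleGraph.disjoint_left.1 hHK v w h1 h2
  have hb1 (e : Sym2 V) : b e = 1 ↔ b e ≠ 0 := by
    generalize b e = z
    revert z
    decide
  have hle (w : V) : (H.Adj v w → G.Adj v w) ∧ (K.Adj v w → G.Adj v w) :=
    ⟨fun h => hH h, fun h => hK h⟩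
  fin_cases j
  · convert hb v 0 using 1
    ext w
    simp only [SimpleGraph.mem_edgeSet, Set.mem_ofPred_eq, SimpleGraph.sdiff_adj,
      SimpleGraph.sup_adj]
    grind
  · convert hb v 1 using 1
    ext w
    simp only [SimpleGraph.mem_edgeSet, Set.mem_ofPred_eq, SimpleGraph.sdiff_adj,
      SimpleGraph.sup_adj, hb1]
    grind
  · convert hHodd v using 1
    ext w
    simp only [SimpleGraph.mem_edgeSet, Set.mem_ofPred_eq, SimpleGraph.mem_neighborSet]
    grind
  · convert hKodd v using 1
    ext w
    simp only [SimpleGraph.mem_edgeSet, Set.mem_ofPred_eq, SimpleGraph.mem_neighborSet]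
    grind

lemma SimpleGraph.Connected.exists_forall_reachable_deleteIncidenceSet {V : Type*} [Finite V]
    {G : SimpleGraph V} (hG : G.Connected) :
    ∃ v, ∀ x ≠ v, ∀ y ≠ v, (G.deleteIncidenceSet v).Reachable x y := by
  obtain hV | hV := subsingleton_or_nontrivial V
  · obtain ⟨v⟩ := hG.nonempty
    exact ⟨v, fun x hx => absurd (Subsingleton.elim x v) hx⟩
  · obtain ⟨v, hv⟩ := hG.exists_connected_induce_compl_singleton_of_finite_nontrivial
    refine ⟨v, fun x hx y hy => ?_⟩
    let f : G.induce {v}ᶜ →g G.deleteIncidenceSet v :=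
      ⟨Subtype.val, fun {p q} h => by
        rw [SimpleGraph.deleteIncidenceSet_adj]
        exact ⟨h, p.2, q.2⟩⟩
    exact (hv.preconnected ⟨x, hx⟩ ⟨y, hy⟩).map f

lemma exists_odd_four_coloring_neighborSet {V : Type*} [Fintype V] {G : SimpleGraph V}
    (hG : G.Connected) :
    ∃ φ : Sym2 V → Fin 4, ∀ v j, {w | G.Adj v w ∧ φ s(v, w) = j}.ZeroOrOddCard := by
  classical
  have := hG.nonempty
  obtain hcard | hcard := Nat.even_or_odd (Fintype.card V)
  · obtain ⟨H, hle, hac, hodd⟩ := exists_odd_subgraph_isAcyclic_sdiff (G := G) (S := univ)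
      (by rwa [Finset.card_univ]) fun u _ v _ => hG.preconnected u v
    refine exists_odd_four_coloring_of_decomposition hle bot_le disjoint_bot_right
      (fun v => .inr (hodd v (mem_univ v))) (fun v => .inl (by simp)) ?_
    rw [sup_bot_eq]
    exact exists_potential_of_isAcyclic hac
  · obtain ⟨v, hv⟩ := hG.exists_forall_reachable_deleteIncidenceSet
    obtain ⟨H, hle, hac, hodd⟩ := exists_odd_subgraph_isAcyclic_sdiff
      (G := G.deleteIncidenceSet v) (S := univ.erase v)
      (by
        rw [Finset.card_erase_of_mem (mem_univ v), Finset.card_univ]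
        exact Nat.Odd.sub_odd hcard odd_one)
      fun x hx y hy => hv x (ne_of_mem_erase hx) y (ne_of_mem_erase hy)
    obtain ⟨t, ht, htodd, z, hz⟩ :=
      exists_subset_zeroOrOddCard_diff_subset_singleton (G.neighborSet v)
    have hHadj (x y : V) (h : H.Adj x y) : G.Adj x y ∧ x ≠ v ∧ y ≠ v :=
      SimpleGraph.deleteIncidenceSet_adj.1 (hle h)
    have hvt : v ∉ t := fun h => G.irrefl (ht h)
    let K : SimpleGraph V :=
      { Adj x y := (x = v ∧ y ∈ t) ∨ (y = v ∧ x ∈ t)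
        symm := ⟨fun x y h => h.symm⟩
        loopless := ⟨fun x h => by grind⟩ }
    refine exists_odd_four_coloring_of_decomposition (H := H) (K := K)
      (fun x y h => (hHadj x y h).1) ?_ ?_ (fun x => ?_) (fun x => ?_) fun y => ?_
    · rintro x y (⟨rfl, h⟩ | ⟨rfl, h⟩)
      · exact ht h
      · exact (ht h).symm
    · rw [SimpleGraph.disjoint_left]
      rintro x y h (⟨rfl, -⟩ | ⟨rfl, -⟩)
      · exact (hHadj _ _ h).2.1 rfl
      · exact (hHadj _ _ h).2.2 rfl
    · by_cases hx : x = v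
      · subst hx
        refine .inl ?_
        rw [Set.ncard_eq_zero, Set.eq_empty_iff_forall_notMem]
        exact fun y h => (hHadj _ _ h).2.1 rfl
      · exact .inr (hodd x (by simp [hx]))
    · by_cases hx : x = v
      · subst hx
        convert htodd using 1
        ext y
        simp [K, hvt]
      · refine (Set.subsingleton_singleton (a := v)).anti (fun y hy => ?_) |>.zeroOrOddCard
        obtain h | h := hy
        · exact absurd h.1 hx
        · exact h.1
    · obtain ⟨a, ha⟩ := exists_potential_of_isAcyclic hac y
      have hvz (x : V) (hvx : G.Adj v x) (hxt : x ∉ t) : x = z := hz ⟨hvx, hxt⟩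
      refine ⟨Function.update a v (y s(v, z) + a z), fun p q hpq => ?_⟩
      obtain ⟨hG', hn⟩ := hpq
      simp only [SimpleGraph.sup_adj, not_or] at hn
      by_cases hp : p = v
      · subst hp
        have hqt : q ∉ t := fun h => hn.2 (.inl ⟨rfl, h⟩)
        obtain rfl := hvz q hG' hqt
        rw [Function.update_self, Function.update_of_ne hG'.ne', add_assoc,
          CharTwo.add_self_eq_zero, add_zero]
      · by_cases hq : q = v
        · subst hq
          have hpt : p ∉ t := fun h => hn.2 (.inr ⟨rfl, h⟩)
          obtain rfl := hvz p hG'.symm hpt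
          rw [Function.update_self, Function.update_of_ne hp, add_left_comm,
            CharTwo.add_self_eq_zero, add_zero, Sym2.eq_swap]
        · rw [Function.update_of_ne hp, Function.update_of_ne hq]
          exact ha p q ⟨SimpleGraph.deleteIncidenceSet_adj.2 ⟨hG', hp, hq⟩, hn.1⟩

/-- For every connected simple graph `G`, the edge set of `G` can be partitioned into
at most 4 classes such that each class induces a subgraph in which every non-isolated
vertex has odd degree. -/
theorem stmt_1 {V : Type*} [Fintype V] (G : SimpleGraph V) (hG : G.Connected) :
    ∃ φ : Sym2 V → Fin 4, ∀ (v : V) (j : Fin 4),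
      {e | e ∈ G.edgeSet ∧ φ e = j ∧ v ∈ e}.ncard = 0 ∨
        Odd {e | e ∈ G.edgeSet ∧ φ e = j ∧ v ∈ e}.ncard := by
  obtain ⟨φ, hφ⟩ := exists_odd_four_coloring_neighborSet hG
  refine ⟨φ, fun v j => ?_⟩
  have himage : {e | e ∈ G.edgeSet ∧ φ e = j ∧ v ∈ e}
      = (fun w => s(v, w)) '' {w | G.Adj v w ∧ φ s(v, w) = j} := by
    ext e
    constructor
    · rintro ⟨he, hj, w, rfl⟩
      exact ⟨w, ⟨he, hj⟩, rfl⟩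
    · rintro ⟨w, ⟨he, hj⟩, rfl⟩
      exact ⟨he, hj, Sym2.mem_mk_left v w⟩
  rw [himage, Set.ncard_image_of_injective _ fun _ _ h => Sym2.congr_right.1 h]
  exact hφ v j
end

section
/- Let T be a tree with at least 3 vertices and let M be a subgraph of T each of whose connected components is a star with 1 or 2 leaves, where all leaves of M are leaves of T, the total number of leaves over all components of M is even, M has at least 2 components, and at least two components of M are stars with exactly one leaf. Then there exists an edge e of T not in M such that T − e splits into two subtrees L and R, each of which contains an odd number of leaves of M. -/
open SimpleGraph in
/-- In an acyclic graph, a vertex reachable from a neighbour `w` of `c` after deleting the edge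
`cw` is joined to `c` by a path whose first step goes to `w`. -/
lemma SimpleGraph.IsAcyclic.exists_isPath_cons {V : Type*} {G : SimpleGraph V}
    (hG : G.IsAcyclic) {c w a : V} (h : G.Adj c w)
    (hr : (G.deleteEdges {s(c, w)}).Reachable w a) :
    ∃ q : G.Walk w a, (Walk.cons h q).IsPath := by
  classical
  obtain ⟨q, hq⟩ := hr.exists_isPath
  refine ⟨q.mapLe (deleteEdges_le _), ?_⟩
  rw [Walk.cons_isPath_iff]
  refine ⟨hq.mapLe _, fun hc => ?_⟩
  have hc' : c ∈ q.support := by simpa using hc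
  have hb := isAcyclic_iff_forall_adj_isBridge.1 hG h
  rw [isBridge_iff] at hb
  exact hb ⟨(q.takeUntil c hc').reverse⟩

open SimpleGraph in
/-- The tail of a path starting with the edge `cw` avoids every edge at `c`. -/
lemma SimpleGraph.Walk.IsPath.reachable_deleteEdges_of_cons {V : Type*} {G : SimpleGraph V}
    {c w a : V} {h : G.Adj c w} {q : G.Walk w a} (hq : (Walk.cons h q).IsPath) (x : V) :
    (G.deleteEdges {s(c, x)}).Reachable w a := by
  rw [Walk.cons_isPath_iff] at hq
  exact ⟨q.toDeleteEdge s(c, x) fun he => hq.2 (q.fst_mem_support_of_mem_edges he)⟩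

open SimpleGraph in
/-- Every vertex of a tree other than `c` lies in exactly one branch at `c`. -/
lemma SimpleGraph.IsTree.existsUnique_branch {V : Type*} {G : SimpleGraph V}
    (hG : G.IsTree) {c a : V} (hca : a ≠ c) :
    ∃! w, G.Adj c w ∧ (G.deleteEdges {s(c, w)}).Reachable w a := by
  obtain ⟨p, hp⟩ := (hG.connected c a).exists_isPath
  cases p with
  | nil => exact absurd rfl hca
  | @cons _ w _ h q =>
    refine ⟨w, ⟨h, hp.reachable_deleteEdges_of_cons w⟩, ?_⟩
    rintro x ⟨hx, hr⟩
    obtain ⟨r, hr⟩ := hG.isAcyclic.exists_isPath_cons hx hr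
    have := congrArg Subtype.val ((hG.isAcyclic.subsingleton_path c a).elim ⟨_, hp⟩ ⟨_, hr⟩)
    simp only [Walk.cons.injEq] at this
    exact this.1.symm

open SimpleGraph in
/-- Deleting an edge `cw` of a tree separates the vertices reachable from `c` from those
reachable from `w`. -/
lemma SimpleGraph.IsTree.reachable_deleteEdges_iff_not {V : Type*} {G : SimpleGraph V}
    (hG : G.IsTree) {c w : V} (h : G.Adj c w) (a : V) :
    (G.deleteEdges {s(c, w)}).Reachable c a ↔ ¬ (G.deleteEdges {s(c, w)}).Reachable w a := by
  have hb := isAcyclic_iff_forall_adj_isBridge.1 hG.isAcyclic h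
  rw [isBridge_iff] at hb
  refine ⟨fun h₁ h₂ => hb (h₁.trans h₂.symm), fun hn => ?_⟩
  obtain ⟨p, hp⟩ := (hG.connected c a).exists_isPath
  cases p with
  | nil => exact Reachable.refl _
  | @cons _ x _ hx q =>
    have hr := hp.reachable_deleteEdges_of_cons w
    have hxw : x ≠ w := by
      rintro rfl
      exact hn hr
    refine Reachable.trans (Adj.reachable ?_) hr
    simp [deleteEdges_adj, hx, hxw, hx.ne']

open SimpleGraph in
/-- A leaf is the only vertex of its component once its edge is deleted. -/
lemma SimpleGraph.eq_of_reachable_deleteEdges_of_degree_eq_one {V : Type*} {G : SimpleGraph V}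
    {c u a : V} [Fintype (G.neighborSet u)] (h : G.Adj c u) (hu : G.degree u = 1)
    (hr : (G.deleteEdges {s(c, u)}).Reachable u a) : a = u := by
  obtain ⟨p⟩ := hr
  cases p with
  | nil => rfl
  | @cons _ x _ hx _ =>
    rw [deleteEdges_adj] at hx
    obtain ⟨y, -, hy⟩ := degree_eq_one_iff_existsUnique_adj.1 hu
    obtain rfl : x = c := (hy x hx.1).trans (hy c h.symm).symm
    exact absurd (by simp [Sym2.eq_swap]) hx.2

open SimpleGraph in
/-- If `c` is adjacent to a leaf `u` of a tree and `A` is a set of vertices of even size that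
contains `u` but not `c`, then some edge at `c` other than `cu` splits `A` into two odd parts. -/
lemma SimpleGraph.IsTree.exists_adj_odd_odd {V : Type*} [Fintype V] {G : SimpleGraph V}
    [DecidableRel G.Adj] (hG : G.IsTree) {c u : V} (hcu : G.Adj c u) (hu : G.degree u = 1)
    {A : Finset V} (hA : Even A.card) (huA : u ∈ A) (hcA : c ∉ A) :
    ∃ w, G.Adj c w ∧ w ≠ u ∧
      Odd {a : V | a ∈ A ∧ (G.deleteEdges {s(c, w)}).Reachable c a}.ncard ∧
      Odd {a : V | a ∈ A ∧ (G.deleteEdges {s(c, w)}).Reachable w a}.ncard := by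
  classical
  let B : V → Finset V := fun w => A.filter ((G.deleteEdges {s(c, w)}).Reachable w)
  have hsum : A.card = ∑ w ∈ G.neighborFinset c, (B w).card := by
    rw [← Finset.card_biUnion]
    · congr 1
      ext a
      simp only [B, Finset.mem_biUnion, mem_neighborFinset, Finset.mem_filter]
      refine ⟨fun ha => ?_, fun ⟨_, _, ha, _⟩ => ha⟩
      obtain ⟨w, ⟨hw, hr⟩, -⟩ := hG.existsUnique_branch (ne_of_mem_of_not_mem ha hcA)
      exact ⟨w, hw, ha, hr⟩
    · intro x hx y hy hxy
      rw [Function.onFun, Finset.disjoint_left]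
      intro a hax hay
      simp only [B, Finset.mem_filter] at hax hay
      simp only [Finset.mem_coe, mem_neighborFinset] at hx hy
      exact hxy ((hG.existsUnique_branch (ne_of_mem_of_not_mem hax.1 hcA)).unique
        ⟨hx, hax.2⟩ ⟨hy, hay.2⟩)
  have hBu : B u = {u} := by
    ext a
    simp only [B, Finset.mem_filter, Finset.mem_singleton]
    refine ⟨fun ha => eq_of_reachable_deleteEdges_of_degree_eq_one hcu hu ha.2, ?_⟩
    rintro rfl
    exact ⟨huA, Reachable.refl _⟩
  obtain ⟨w, hw, hwu, hodd⟩ : ∃ w, G.Adj c w ∧ w ≠ u ∧ Odd (B w).card := by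
    by_contra! hcon
    rw [← Finset.add_sum_erase _ _ ((mem_neighborFinset G c u).2 hcu), hBu,
      Finset.card_singleton] at hsum
    have : Even (∑ w ∈ (G.neighborFinset c).erase u, (B w).card) := by
      refine Finset.even_sum _ fun w hw => ?_
      rw [Finset.mem_erase, mem_neighborFinset] at hw
      exact Nat.not_odd_iff_even.1 (hcon w hw.2 hw.1)
    grind
  have hcompl : {a : V | a ∈ A ∧ (G.deleteEdges {s(c, w)}).Reachable c a} =
      (A.filter fun a => ¬ (G.deleteEdges {s(c, w)}).Reachable w a : Finset V) := by
    ext a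
    simp [hG.reachable_deleteEdges_iff_not hw a]
  have hside : {a : V | a ∈ A ∧ (G.deleteEdges {s(c, w)}).Reachable w a} = (B w : Set V) := by
    ext a
    simp [B]
  refine ⟨w, hw, hwu, ?_, ?_⟩
  · rw [hcompl, Set.ncard_coe_finset]
    have := Finset.card_filter_add_card_filter_not (s := A) ((G.deleteEdges {s(c, w)}).Reachable w)
    grind
  · rwa [hside, Set.ncard_coe_finset]

/-- Let `T` be a tree with at least 3 vertices and let `M` be a subgraph of `T`,
given as a disjoint collection `S` of stars (center, leaf set) with 1 or 2 leaves,
whose leaves are leaves of `T`. If the total number of leaves of `M` is even, `M`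
has at least 2 components and at least two components are stars with one leaf, then
there is an edge of `T` not in `M` whose removal splits `T` into two subtrees each
containing an odd number of leaves of `M`. -/
theorem stmt_6 {V : Type*} [Fintype V] [DecidableEq V] (T : SimpleGraph V)
    [DecidableRel T.Adj]
    (hT : T.IsTree) (hcard : 3 ≤ Fintype.card V)
    (S : Finset (V × Finset V))
    (hstar : ∀ p ∈ S, (p.2.card = 1 ∨ p.2.card = 2) ∧ p.1 ∉ p.2 ∧
      ∀ u ∈ p.2, T.Adj p.1 u ∧ T.degree u = 1)
    (hdisj : ∀ p ∈ S, ∀ q ∈ S, p ≠ q →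
      Disjoint (insert p.1 p.2) (insert q.1 q.2))
    (heven : Even (∑ p ∈ S, p.2.card))
    (hcomp : 2 ≤ S.card)
    (hS1 : 2 ≤ (S.filter (fun p => p.2.card = 1)).card) :
    ∃ a b : V, T.Adj a b ∧
      (∀ p ∈ S, ∀ u ∈ p.2, s(a, b) ≠ s(p.1, u)) ∧
      Odd {u : V | (∃ p ∈ S, u ∈ p.2) ∧
        (T.deleteEdges {s(a, b)}).Reachable a u}.ncard ∧
      Odd {u : V | (∃ p ∈ S, u ∈ p.2) ∧
        (T.deleteEdges {s(a, b)}).Reachable b u}.ncard := by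
  obtain ⟨p, hp⟩ := Finset.card_pos.1 (by omega : 0 < (S.filter fun p => p.2.card = 1).card)
  rw [Finset.mem_filter] at hp
  obtain ⟨hpS, hp1⟩ := hp
  obtain ⟨u, hu⟩ := Finset.card_eq_one.1 hp1
  obtain ⟨-, hc, hadj⟩ := hstar p hpS
  obtain ⟨hcu, hdeg⟩ := hadj u (by simp [hu])
  have hother : ∀ q ∈ S, q ≠ p → p.1 ≠ q.1 ∧ p.1 ∉ q.2 := by
    intro q hq hqp
    have := Finset.disjoint_left.1 (hdisj p hpS q hq hqp.symm) (Finset.mem_insert_self _ _)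
    simpa using this
  have hcA : p.1 ∉ S.biUnion Prod.snd := by
    simp only [Finset.mem_biUnion, not_exists, not_and]
    intro q hq
    by_cases hqp : q = p
    · rwa [hqp]
    · exact (hother q hq hqp).2
  have hA : Even (S.biUnion Prod.snd).card := by
    rwa [Finset.card_biUnion]
    exact fun x hx y hy hxy =>
      (hdisj x hx y hy hxy).mono (Finset.subset_insert _ _) (Finset.subset_insert _ _)
  obtain ⟨w, hw, hwu, h₁, h₂⟩ := hT.exists_adj_odd_odd hcu hdeg hA
    (Finset.mem_biUnion.2 ⟨p, hpS, by simp [hu]⟩) hcA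
  simp only [Finset.mem_biUnion] at h₁ h₂
  refine ⟨p.1, w, hw, fun q hq v hv he => ?_, h₁, h₂⟩
  have hpv : p.1 ≠ v := by
    rintro rfl
    exact hcA (Finset.mem_biUnion.2 ⟨q, hq, hv⟩)
  obtain ⟨hpq, rfl⟩ : p.1 = q.1 ∧ w = v := by
    simpa [hpv] using he
  obtain rfl : q = p := by
    by_contra hqp
    exact (hother q hq hqp).1 hpq
  rw [hu, Finset.mem_singleton] at hv
  exact hwu hv
end

section
/- Let H be a connected graph containing a cycle with a vertex v such that H − v is acyclic. Suppose the odd chromatic index of H equals 3, d_H(v) is even, and v has at least 2 neighbors joined to v by exactly one edge. Then there exists an edge e of H such that H \ {e} admits an odd 2-edge-coloring. -/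
/-- A set `S` of edges of a loopless multigraph is acyclic iff every nonempty subset
of `S` has a vertex incident to exactly one of its edges. -/
def MultigraphAcyclic {V E : Type*} (ends : E → Sym2 V) (S : Set E) : Prop :=
  ∀ F : Set E, F ⊆ S → F.Nonempty →
    ∃ (v : V) (e : E), e ∈ F ∧ v ∈ ends e ∧ ∀ f ∈ F, v ∈ ends f → f = e

open Classical in
/-- Local constraints of an odd 2-edge-coloring as a linear map over `ZMod 2`: the edges at a
vertex of odd degree get equal values, those at a vertex of even degree are summed. -/
noncomputable def oddColoringMap {V E : Type*} (δ : V → Finset E) :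
    (E → ZMod 2) →ₗ[ZMod 2] (V → E → E → ZMod 2) where
  toFun x u e f :=
    if Odd (δ u).card then (if e ∈ δ u ∧ f ∈ δ u then x e - x f else 0) else ∑ g ∈ δ u, x g
  map_add' x y := by
    ext u e f
    simp only [Pi.add_apply, Finset.sum_add_distrib]
    split_ifs <;> ring
  map_smul' r x := by
    ext u e f
    simp only [Pi.smul_apply, smul_eq_mul, RingHom.id_apply, ← Finset.mul_sum]
    split_ifs <;> ring

open Classical in
/-- The right-hand side of the linear system describing odd 2-edge-colorings. -/
noncomputable def oddColoringTarget {V E : Type*} (δ : V → Finset E) : V → E → E → ZMod 2 :=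
  fun u _ _ => if Odd (δ u).card ∨ δ u = ∅ then 0 else 1

lemma odd_card_filter_of_sum_eq_one {E : Type*} (s : Finset E) (x : E → ZMod 2)
    (h : ∑ e ∈ s, x e = 1) : Odd (s.filter (fun e => x e = 1)).card := by
  have hx : ∀ a : ZMod 2, a = if a = 1 then 1 else 0 := by decide
  rw [Finset.sum_congr rfl (fun e _ => hx (x e)), Finset.sum_boole] at h
  exact (ZMod.natCast_eq_one_iff_odd).1 h

lemma odd_coloring_of_oddColoringMap_eq {V E : Type*} (δ : V → Finset E) (x : E → ZMod 2)
    (hx : oddColoringMap δ x = oddColoringTarget δ) (u : V) (j : ZMod 2) :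
    ((δ u).filter (fun e => x e = j)).card = 0 ∨
      Odd ((δ u).filter (fun e => x e = j)).card := by
  have hu : ∀ e f, oddColoringMap δ x u e f = oddColoringTarget δ u e f := by simp [hx]
  simp only [oddColoringMap, oddColoringTarget, LinearMap.coe_mk, AddHom.coe_mk] at hu
  rcases (δ u).eq_empty_or_nonempty with h0 | ⟨e, he⟩
  · simp [h0]
  have hne : δ u ≠ ∅ := Finset.ne_empty_of_mem he
  by_cases ho : Odd (δ u).card
  · have hconst : ∀ f ∈ δ u, x f = x e := fun f hf => by
      have := hu f e
      simp only [ho, he, hf, and_self, if_true, true_or] at this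
      exact sub_eq_zero.1 this
    by_cases hj : x e = j
    · right
      rwa [Finset.filter_true_of_mem (fun f hf => (hconst f hf).trans hj)]
    · left
      rw [Finset.filter_false_of_mem (fun f hf => by rwa [hconst f hf]), Finset.card_empty]
  · right
    have hsum : ∑ g ∈ δ u, x g = 1 := by simpa [ho, hne] using hu e e
    have h1 := odd_card_filter_of_sum_eq_one _ _ hsum
    have hj : j = 1 ∨ j = 0 := by revert j; decide
    rcases hj with rfl | rfl
    · exact h1
    · have hsplit := Finset.card_filter_add_card_filter_not (s := δ u) (fun e => x e = 1)
      have hz : (δ u).filter (fun e => ¬ x e = 1) = (δ u).filter (fun e => x e = 0) := by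
        refine Finset.filter_congr fun f _ => ?_
        generalize x f = a
        revert a; decide
      rw [hz] at hsplit
      rw [Nat.not_odd_iff_even, ← hsplit] at ho
      by_contra h2
      rw [Nat.not_odd_iff_even] at h2
      exact Nat.not_even_iff_odd.2 (h1.add_even h2) ho

open Classical in
/-- An infeasible system of odd 2-edge-coloring constraints has a dual certificate. -/
lemma exists_incidence_certificate {V E : Type*} [Fintype V] (δ : V → Finset E)
    (h : oddColoringTarget δ ∉ LinearMap.range (oddColoringMap δ)) :
    ∃ c : V → E → ZMod 2, (∃ u e, e ∈ δ u ∧ c u e ≠ 0) ∧ (∀ u e, e ∉ δ u → c u e = 0) ∧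
      (∀ e, ∑ u, c u e = 0) ∧ (∀ u, ∑ e ∈ δ u, c u e = 0) ∧
      (∀ u, Even (δ u).card → ∀ e ∈ δ u, ∀ f ∈ δ u, c u e = c u f) := by
  obtain ⟨φ, hφ, hker⟩ := Submodule.exists_le_ker_of_notMem h
  have hvan : ∀ x, φ (oddColoringMap δ x) = 0 := fun x => hker ⟨x, rfl⟩
  have hsum : ∀ m : V → E → E → ZMod 2, ∑ u, φ (Pi.single u (m u)) = φ m := fun m => by
    rw [← map_sum, Finset.univ_sum_single]
  let B (u : V) : (E → ZMod 2) →ₗ[ZMod 2] ZMod 2 :=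
    φ ∘ₗ LinearMap.single (ZMod 2) (fun _ : V => E → E → ZMod 2) u ∘ₗ
      LinearMap.proj u ∘ₗ oddColoringMap δ
  have hB : ∀ u x, B u x = φ (Pi.single u (oddColoringMap δ x u)) := fun _ _ => rfl
  have heven : ∀ u, ¬ Odd (δ u).card → ∀ e ∈ δ u,
      oddColoringMap δ (Pi.single e 1) u = fun _ _ => 1 := fun u hu e he => by
    funext f g
    simp [oddColoringMap, hu, Pi.single_apply, he]
  refine ⟨fun u e => B u (Pi.single e 1), ?_, ?_, ?_, ?_, ?_⟩
  · by_contra! hc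
    refine hφ ?_
    rw [← hsum]
    refine Finset.sum_eq_zero fun u _ => ?_
    by_cases hu : Odd (δ u).card ∨ δ u = ∅
    · have : oddColoringTarget δ u = 0 := by funext e f; simp [oddColoringTarget, hu]
      simp [this]
    · push Not at hu
      obtain ⟨e, he⟩ := hu.2
      have : oddColoringTarget δ u = oddColoringMap δ (Pi.single e 1) u := by
        rw [heven u (by simpa using hu.1) e he]
        funext _ _
        simp only [oddColoringTarget]
        rw [if_neg]
        push Not
        exact hu
      rw [this, ← hB]
      exact hc u e he
  · intro u e he
    have : oddColoringMap δ (Pi.single e 1) u = 0 := by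
      funext f g
      simp only [oddColoringMap, LinearMap.coe_mk, AddHom.coe_mk, Pi.zero_apply]
      split_ifs with _ hfg
      · rw [Pi.single_eq_of_ne (by rintro rfl; exact he hfg.1),
          Pi.single_eq_of_ne (by rintro rfl; exact he hfg.2), sub_zero]
      · rfl
      · exact Finset.sum_eq_zero fun g hg =>
          Pi.single_eq_of_ne (by rintro rfl; exact he hg) _
    simp [hB, this]
  · intro e
    simp only [hB]
    rw [hsum, hvan]
  · intro u
    rw [← map_sum, hB]
    have : oddColoringMap δ (∑ e ∈ δ u, Pi.single e 1) u = 0 := by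
      funext f g
      simp only [oddColoringMap, LinearMap.coe_mk, AddHom.coe_mk, Pi.zero_apply,
        Finset.sum_apply, Pi.single_apply, Finset.sum_ite_eq]
      split_ifs with ho hfg hf hg <;> first | rfl | skip
      all_goals simp_all
      exact (ZMod.natCast_eq_zero_iff_even).2 ho
    simp [this]
  · intro u hu e he f hf
    rw [← Nat.not_odd_iff_even] at hu
    simp only [hB, heven u hu e he, heven u hu f hf]

open Classical in
/-- If the spanning subgraph with edge set `S` has no odd 2-edge-coloring, then some nonempty
even subgraph of it contains, at each vertex of even degree, all edges or none. -/
lemma exists_even_subgraph_of_not_odd_two_colorable {V E : Type*} [Fintype V] [Fintype E]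
    (ends : E → Sym2 V) (S : Set E)
    (h : ¬ ∃ φ : E → Fin 2, ∀ (u : V) (j : Fin 2),
      {e | e ∈ S ∧ φ e = j ∧ u ∈ ends e}.ncard = 0 ∨
        Odd {e | e ∈ S ∧ φ e = j ∧ u ∈ ends e}.ncard) :
    ∃ q : E → ZMod 2, (∃ e, q e ≠ 0) ∧ (∀ e, e ∉ S → q e = 0) ∧
      (∀ u, ∑ e with u ∈ ends e, q e = 0) ∧
      (∀ u, Even {e | e ∈ S ∧ u ∈ ends e}.ncard → ∀ e f, e ∈ S → f ∈ S →
        u ∈ ends e → u ∈ ends f → q e = q f) := by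
  let δ : V → Finset E := fun u => {e | e ∈ S ∧ u ∈ ends e}
  have hδ : ∀ u e, e ∈ δ u ↔ e ∈ S ∧ u ∈ ends e := fun u e => by simp [δ]
  have hnot : oddColoringTarget δ ∉ LinearMap.range (oddColoringMap δ) := by
    rintro ⟨x, hx⟩
    refine h ⟨x, fun u j => ?_⟩
    have hset : ∀ i : ZMod 2, {e | e ∈ S ∧ x e = i ∧ u ∈ ends e}.ncard =
        ((δ u).filter (fun e => x e = i)).card := by
      intro i
      rw [← Set.ncard_coe_finset]
      congr 1
      ext e
      simp only [Set.mem_ofPred_eq, Finset.coe_filter, hδ]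
      tauto
    refine (hset j).symm ▸ ?_
    exact odd_coloring_of_oddColoringMap_eq δ x hx u j
  obtain ⟨c, ⟨u₀, e₀, he₀, hne⟩, hoff, hedge, hvert, hconst⟩ := exists_incidence_certificate δ hnot
  have hsame : ∀ e u w, u ∈ ends e → w ∈ ends e → c u e = c w e := by
    intro e u w hu hw
    by_cases huw : u = w
    · rw [huw]
    have hends : ends e = s(u, w) := (Sym2.mem_and_mem_iff huw).1 ⟨hu, hw⟩
    have hs := hedge e
    rw [← Finset.sum_subset (Finset.subset_univ {u, w}), Finset.sum_pair huw] at hs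
    · exact CharTwo.add_eq_zero.1 hs
    · intro z _ hz
      refine hoff z e fun hze => hz ?_
      simpa [hends] using ((hδ z e).1 hze).2
  have hq : ∀ u e, u ∈ ends e → c u e = c (ends e).out.1 e := fun u e hu =>
    hsame e u _ hu (Sym2.out_fst_mem _)
  refine ⟨fun e => c (ends e).out.1 e, ⟨e₀, ?_⟩, ?_, ?_, ?_⟩
  · dsimp only
    rwa [← hq u₀ e₀ ((hδ _ _).1 he₀).2]
  · exact fun e he => hoff _ _ fun he' => he ((hδ _ _).1 he').1
  · intro u
    rw [← hvert u, ← Finset.sum_subset (s₁ := δ u)]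
    · exact Finset.sum_congr rfl fun e he => (hq u e ((hδ _ _).1 he).2).symm
    · exact fun e he => by simpa using ((hδ _ _).1 he).2
    · intro e he he'
      rw [← hq u e (by simpa using he)]
      exact hoff u e he'
  · intro u hu e f he hf hue huf
    have hset : {e | e ∈ S ∧ u ∈ ends e} = (δ u : Set E) := by
      ext e
      simp [hδ]
    rw [hset, Set.ncard_coe_finset] at hu
    dsimp only
    rw [← hq u e hue, ← hq u f huf]
    exact hconst u hu e ((hδ _ _).2 ⟨he, hue⟩) f ((hδ _ _).2 ⟨hf, huf⟩)

open Classical in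
/-- An acyclic edge set supports no nonzero element of the cycle space. -/
lemma MultigraphAcyclic.eq_zero_of_sum_eq_zero {V E : Type*} [Fintype E] {ends : E → Sym2 V}
    {S : Set E} (hS : MultigraphAcyclic ends S) (q : E → ZMod 2)
    (hsum : ∀ u, ∑ e with u ∈ ends e, q e = 0) (hq : ∀ e, e ∉ S → q e = 0) : q = 0 := by
  by_contra hne
  obtain ⟨e₁, he₁⟩ := Function.ne_iff.1 hne
  obtain ⟨w, e, he, hwe, huniq⟩ := hS {e | q e ≠ 0}
    (fun e he => by by_contra h; exact he (hq e h)) ⟨e₁, he₁⟩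
  refine he ?_
  rw [← hsum w, Finset.sum_eq_single e]
  · intro f hf hfe
    by_contra h
    exact hfe (huniq f h (by simpa using hf))
  · intro h
    exact absurd (by simpa using hwe) h

/-- Let `H` be a connected loopless multigraph containing a cycle, with a vertex `v`
such that `H − v` is acyclic. Suppose the odd chromatic index of `H` equals 3,
`d(v)` is even, and `v` has at least two neighbors joined to it by exactly one edge.
Then there is an edge `e₀` such that `H \ {e₀}` admits an odd 2-edge-coloring. -/
theorem stmt_8 {V E : Type*} [Fintype V] [Fintype E] [Nonempty V]
    (ends : E → Sym2 V)
    (hloopless : ∀ e, ¬ (ends e).IsDiag)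
    (hconn : ∀ u v : V,
      Relation.ReflTransGen (fun a b => ∃ e, ends e = s(a, b)) u v)
    (v : V)
    (hcycle : ¬ MultigraphAcyclic ends Set.univ)
    (hacyclic : MultigraphAcyclic ends {e | v ∉ ends e})
    (hchi3 : (∃ φ : E → Fin 3, ∀ (u : V) (j : Fin 3),
        {e | φ e = j ∧ u ∈ ends e}.ncard = 0 ∨
          Odd {e | φ e = j ∧ u ∈ ends e}.ncard) ∧
      ¬ (∃ φ : E → Fin 2, ∀ (u : V) (j : Fin 2),
        {e | φ e = j ∧ u ∈ ends e}.ncard = 0 ∨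
          Odd {e | φ e = j ∧ u ∈ ends e}.ncard))
    (hdeg : Even {e | v ∈ ends e}.ncard)
    (hN' : 2 ≤ {u : V | {e | ends e = s(v, u)}.ncard = 1}.ncard) :
    ∃ e₀ : E, ∃ φ : E → Fin 2, ∀ (u : V) (j : Fin 2),
      {e | e ≠ e₀ ∧ φ e = j ∧ u ∈ ends e}.ncard = 0 ∨
        Odd {e | e ≠ e₀ ∧ φ e = j ∧ u ∈ ends e}.ncard := by
  classical
  by_contra! hcon
  have hzero : ∀ q : E → ZMod 2, (∃ e, q e ≠ 0) → (∀ u, ∑ e with u ∈ ends e, q e = 0) →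
      (∀ e f, v ∈ ends e → v ∈ ends f → q e = q f) → ∀ e, v ∈ ends e → q e = 1 := by
    rintro q ⟨e₁, he₁⟩ hsum hc e he
    by_contra h
    have h0 : q e = 0 := by
      revert h
      generalize q e = a
      revert a; decide
    refine he₁ (congrFun (hacyclic.eq_zero_of_sum_eq_zero q hsum fun f hf => ?_) e₁)
    rw [← h0]
    exact hc f e (not_not.1 hf) he
  obtain ⟨q, hqne, -, hqsum, hqconst⟩ :=
    exists_even_subgraph_of_not_odd_two_colorable ends Set.univ (by
      simpa using hchi3.2)
  have hq1 := hzero q hqne hqsum fun e f he hf =>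
    hqconst v (by simpa using hdeg) e f trivial trivial he hf
  obtain ⟨u, hu⟩ := (Set.ncard_pos).1 (lt_of_lt_of_le two_pos hN')
  obtain ⟨e₁, he₁⟩ := Set.ncard_eq_one.1 hu
  have hends₁ : ∀ e, ends e = s(v, u) ↔ e = e₁ := fun e => Set.ext_iff.1 he₁ e
  have hue₁ : ends e₁ = s(v, u) := (hends₁ e₁).2 rfl
  have hvu : v ≠ u := by
    rintro rfl
    exact hloopless e₁ (by simp [hue₁])
  obtain ⟨e₀, hue₀, hne, hqe₀⟩ : ∃ e₀, u ∈ ends e₀ ∧ e₀ ≠ e₁ ∧ q e₀ ≠ 0 := by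
    by_contra! h
    have hs := hqsum u
    rw [Finset.sum_eq_single e₁ (fun e he hne => h e (by simpa using he) hne)
      (fun h' => absurd (by simp [hue₁]) h'), hq1 e₁ (by simp [hue₁])] at hs
    exact one_ne_zero hs
  have hve₀ : v ∉ ends e₀ := fun hv =>
    hne ((hends₁ e₀).1 ((Sym2.mem_and_mem_iff hvu).1 ⟨hv, hue₀⟩))
  have hS : ∀ e, v ∈ ends e → e ∈ {e | e ≠ e₀} := fun e he h => hve₀ (h ▸ he)
  obtain ⟨q', hq'ne, hq'off, hq'sum, hq'const⟩ :=
    exists_even_subgraph_of_not_odd_two_colorable ends {e | e ≠ e₀} (by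
      rintro ⟨φ, hφ⟩
      obtain ⟨w, j, h0, h1⟩ := hcon e₀ φ
      rcases hφ w j with h | h
      · exact h0 h
      · exact absurd h (by simpa using h1))
  have hset : {e | e ∈ {e | e ≠ e₀} ∧ v ∈ ends e} = {e | v ∈ ends e} :=
    Set.ext fun e => ⟨And.right, fun he => ⟨hS e he, he⟩⟩
  have hq'1 := hzero q' hq'ne hq'sum fun e f he hf =>
    hq'const v (by rwa [hset]) e f (hS e he) (hS f hf) he hf
  have hdiff : q - q' = 0 := by
    refine hacyclic.eq_zero_of_sum_eq_zero _ (fun w => ?_) fun e he => ?_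
    · simp [hqsum, hq'sum]
    · have he' : v ∈ ends e := not_not.1 he
      simp [hq1 e he', hq'1 e he']
  exact hqe₀ ((congrFun (sub_eq_zero.1 hdiff) e₀).trans (hq'off e₀ (by simp)))
end

section
/- For any connected loopless multigraph G that is not a Shannon triangle of type (2,2,2) or (2,2,1), either G admits an odd 3-edge-coloring, or G admits an odd 4-edge-coloring in which one of the colors is used on exactly one edge. -/
/-- The bouquet of parallel edges between `u` and `w`. -/
def bouquet {V E : Type*} (ends : E → Sym2 V) (u w : V) : Set E :=
  {e | ends e = s(u, w)}

/-- A Shannon triangle of type (2,2,2): three pairwise adjacent vertices, each bouquet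
of positive even size. -/
def IsShannon222 {V E : Type*} [Fintype V] (ends : E → Sym2 V) : Prop :=
  Fintype.card V = 3 ∧ ∀ u w : V, u ≠ w →
    0 < (bouquet ends u w).ncard ∧ Even (bouquet ends u w).ncard

/-- A Shannon triangle of type (2,2,1): three pairwise adjacent vertices, two bouquets
of positive even size and one of odd size. -/
def IsShannon221 {V E : Type*} [Fintype V] (ends : E → Sym2 V) : Prop :=
  Fintype.card V = 3 ∧ ∃ a b c : V, a ≠ b ∧ a ≠ c ∧ b ≠ c ∧
    0 < (bouquet ends a b).ncard ∧ Even (bouquet ends a b).ncard ∧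
    0 < (bouquet ends a c).ncard ∧ Even (bouquet ends a c).ncard ∧
    Odd (bouquet ends b c).ncard

set_option linter.unusedSectionVars false

namespace OddColoring

section

variable {V E : Type*} [Fintype V] [Fintype E] [DecidableEq V] [DecidableEq E]
  (ends : E → Sym2 V)

/-- Incidence of `e` with `u`, as an element of `ZMod 2`. -/
def inc (e : E) (u : V) : ZMod 2 := if u ∈ ends e then 1 else 0

/-- The degree of `u` in the edge set `S`, modulo 2. -/
def pdeg (S : Finset E) (u : V) : ZMod 2 := ∑ e ∈ S, inc ends e u

/-- The coboundary of `χ` at `e`: for the indicator function of a vertex set, it records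
whether `e` leaves that set. -/
def cob (χ : V → ZMod 2) (e : E) : ZMod 2 := ∑ u, χ u * inc ends e u

/-- `X` has degree zero or an odd degree at `u`. -/
def OddAt (X : Finset E) (u : V) : Prop := (∀ e ∈ X, u ∉ ends e) ∨ pdeg ends X u = 1

/-- `X` and its two color classes under `c` meet `u` oddly. -/
def ValidAt (X : Finset E) (c : E → Bool) (u : V) : Prop :=
  OddAt ends (X.filter (fun e => c e = true)) u ∧ OddAt ends (X.filter (fun e => c e = false)) u

/-- Every edge of `F` is a bridge of `F`. -/
def Forest (F : Finset E) : Prop :=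
  ∀ e ∈ F, ∃ χ : V → ZMod 2, cob ends χ e = 1 ∧ ∀ e' ∈ F, e' ≠ e → cob ends χ e' = 0

/-- All but at most one of the edges split into three odd subgraphs. -/
def Good : Prop :=
  ∃ A B C : Finset E, Disjoint A B ∧ Disjoint A C ∧ Disjoint B C ∧
    (∀ u, OddAt ends A u) ∧ (∀ u, OddAt ends B u) ∧ (∀ u, OddAt ends C u) ∧
    (Finset.univ \ (A ∪ B ∪ C)).card ≤ 1

theorem zmod_two_cases (x : ZMod 2) : x = 0 ∨ x = 1 := by
  revert x; decide

theorem zmod_two_add_self (x : ZMod 2) : x + x = 0 := by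
  revert x; decide

theorem zmod_two_eq_one {x : ZMod 2} (h : x ≠ 0) : x = 1 :=
  (zmod_two_cases x).resolve_left h

variable {ends}

theorem inc_of_mem {e : E} {u : V} (h : u ∈ ends e) : inc ends e u = 1 := if_pos h

theorem inc_of_notMem {e : E} {u : V} (h : u ∉ ends e) : inc ends e u = 0 := if_neg h

theorem ne_of_ends (hl : ∀ e, ¬ (ends e).IsDiag) {e : E} {a b : V} (h : ends e = s(a, b)) :
    a ≠ b := by
  intro hab
  apply hl e
  rw [h, hab]
  exact Sym2.mk_isDiag_iff.2 rfl

theorem cob_eq (hl : ∀ e, ¬ (ends e).IsDiag) (χ : V → ZMod 2) {e : E} {a b : V}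
    (h : ends e = s(a, b)) : cob ends χ e = χ a + χ b := by
  have hab := ne_of_ends hl h
  have : ∀ u, χ u * inc ends e u = (if u = a then χ u else 0) + (if u = b then χ u else 0) := by
    intro u
    simp only [inc, h, Sym2.mem_iff]
    by_cases h1 : u = a
    · subst h1; simp [hab]
    · by_cases h2 : u = b
      · subst h2; simp [h1]
      · simp [h1, h2]
  unfold cob
  rw [Finset.sum_congr rfl (fun u _ => this u), Finset.sum_add_distrib]
  simp

theorem cob_add (χ ψ : V → ZMod 2) (e : E) :
    cob ends (χ + ψ) e = cob ends χ e + cob ends ψ e := by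
  simp [cob, add_mul, Finset.sum_add_distrib]

theorem cob_of_mem (hl : ∀ e, ¬ (ends e).IsDiag) (χ : V → ZMod 2) {e : E} {a b : V}
    (ha : a ∈ ends e) (hb : b ∈ ends e) (hab : a ≠ b) : cob ends χ e = χ a + χ b :=
  cob_eq hl χ ((Sym2.mem_and_mem_iff hab).1 ⟨ha, hb⟩)

theorem exists_ends (e : E) : ∃ a b, ends e = s(a, b) := by
  induction h : ends e with
  | _ a b => exact ⟨a, b, rfl⟩

theorem handshake (χ : V → ZMod 2) (S : Finset E) :
    ∑ u, χ u * pdeg ends S u = ∑ e ∈ S, cob ends χ e := by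
  simp only [pdeg, cob, Finset.mul_sum]
  exact Finset.sum_comm

theorem pdeg_eq_zero {S : Finset E} {u : V} (h : ∀ e ∈ S, u ∉ ends e) : pdeg ends S u = 0 :=
  Finset.sum_eq_zero fun e he => inc_of_notMem (h e he)

theorem pdeg_union {S T : Finset E} (h : Disjoint S T) (u : V) :
    pdeg ends (S ∪ T) u = pdeg ends S u + pdeg ends T u :=
  Finset.sum_union h

theorem pdeg_sdiff {S T : Finset E} (h : T ⊆ S) (u : V) :
    pdeg ends (S \ T) u = pdeg ends S u + pdeg ends T u := by
  have := Finset.sum_sdiff (f := fun e => inc ends e u) h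
  unfold pdeg
  rw [← this, add_assoc, zmod_two_add_self, add_zero]

theorem pdeg_insert {S : Finset E} {e : E} (h : e ∉ S) (u : V) :
    pdeg ends (insert e S) u = inc ends e u + pdeg ends S u :=
  Finset.sum_insert h

theorem pdeg_erase {S : Finset E} {e : E} (h : e ∈ S) (u : V) :
    pdeg ends (S.erase e) u = inc ends e u + pdeg ends S u := by
  unfold pdeg
  rw [← Finset.add_sum_erase S _ h, ← add_assoc, zmod_two_add_self, zero_add]

theorem pdeg_congr {S T : Finset E} {u : V} (h : ∀ e, u ∈ ends e → (e ∈ S ↔ e ∈ T)) :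
    pdeg ends S u = pdeg ends T u := by
  unfold pdeg inc
  rw [← Finset.sum_filter, ← Finset.sum_filter]
  congr 1
  ext e
  simp only [Finset.mem_filter]
  grind

theorem OddAt.congr {S T : Finset E} {u : V} (h : ∀ e, u ∈ ends e → (e ∈ S ↔ e ∈ T))
    (hS : OddAt ends S u) : OddAt ends T u := by
  rcases hS with hS | hS
  · exact Or.inl fun e he hu => hS e ((h e hu).2 he) hu
  · exact Or.inr ((pdeg_congr h) ▸ hS)

theorem ValidAt.congr {X Y : Finset E} {c d : E → Bool} {u : V}
    (h : ∀ e, u ∈ ends e → (e ∈ X ↔ e ∈ Y)) (hc : ∀ e, u ∈ ends e → e ∈ X → c e = d e)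
    (hX : ValidAt ends X c u) : ValidAt ends Y d u := by
  refine ⟨hX.1.congr fun e he => ?_, hX.2.congr fun e he => ?_⟩ <;>
  · simp only [Finset.mem_filter]
    have := h e he
    have := hc e he
    grind

theorem ValidAt.flip {X : Finset E} {c : E → Bool} {u : V}
    (hX : ValidAt ends X c u) : ValidAt ends X (fun e => !c e) u := by
  simpa [ValidAt, and_comm] using hX

theorem pdeg_filter_add (X : Finset E) (c : E → Bool) (u : V) :
    pdeg ends (X.filter (fun e => c e = true)) u + pdeg ends (X.filter (fun e => c e = false)) u
      = pdeg ends X u := by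
  unfold pdeg
  rw [← Finset.sum_filter_add_sum_filter_not X (fun e => c e = true)]
  simp

theorem validAt_of_pdeg {X : Finset E} {c : E → Bool} {u : V} (h0 : pdeg ends X u = 0)
    (h1 : pdeg ends (X.filter (fun e => c e = true)) u = 1) : ValidAt ends X c u := by
  refine ⟨Or.inr h1, Or.inr ?_⟩
  have := pdeg_filter_add (ends := ends) X c u
  rw [h0, h1] at this
  revert this
  generalize pdeg ends (X.filter (fun e => c e = false)) u = y
  revert y; decide

theorem Forest.mono {F F' : Finset E} (hF : Forest ends F) (h : F' ⊆ F) : Forest ends F' := by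
  intro e he
  obtain ⟨χ, h1, h2⟩ := hF e (h he)
  exact ⟨χ, h1, fun e' he' => h2 e' (h he')⟩

theorem forest_empty : Forest ends ∅ := by
  intro e he; simp at he

theorem Forest.insert_leaf (hl : ∀ e, ¬ (ends e).IsDiag) {F : Finset E} (hF : Forest ends F)
    {e : E} {a b : V} (he : ends e = s(a, b)) (ha : ∀ e' ∈ F, a ∉ ends e') :
    Forest ends (insert e F) := by
  have hab := ne_of_ends hl he
  have hsingle : ∀ x : ZMod 2, ∀ e' ∈ F, cob ends (Pi.single a x) e' = 0 := by
    intro x e' he'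
    obtain ⟨p, q, hpq⟩ := exists_ends (ends := ends) e'
    have := ha e' he'
    rw [hpq, Sym2.mem_iff, not_or] at this
    rw [cob_eq hl _ hpq, Pi.single_eq_of_ne (Ne.symm this.1), Pi.single_eq_of_ne (Ne.symm this.2),
      add_zero]
  intro e' he'
  by_cases hee : e' = e
  · subst hee
    refine ⟨Pi.single a 1, ?_, fun e'' h'' hne => ?_⟩
    · rw [cob_eq hl _ he]; simp [hab.symm]
    · exact hsingle 1 e'' (Finset.mem_of_mem_insert_of_ne h'' hne)
  · have he'F := Finset.mem_of_mem_insert_of_ne he' hee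
    obtain ⟨χ, h1, h2⟩ := hF e' he'F
    refine ⟨χ + Pi.single a (χ a + χ b), ?_, fun e'' h'' hne => ?_⟩
    · rw [cob_add, hsingle _ e' he'F, h1, add_zero]
    · by_cases h3 : e'' = e
      · subst h3
        rw [cob_add, cob_eq hl _ he, cob_eq hl _ he]
        simp [hab.symm, zmod_two_add_self]
      · have h4 := Finset.mem_of_mem_insert_of_ne h'' h3
        rw [cob_add, hsingle _ e'' h4, h2 e'' h4 hne, add_zero]

/-- A prescribed parity function is realized by a forest inside `S` as soon as its sum over every
union of components of `S` vanishes. -/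
theorem exists_join (S : Finset E) : ∀ (t : V → ZMod 2),
    (∀ χ : V → ZMod 2, (∀ e ∈ S, cob ends χ e = 0) → ∑ u, χ u * t u = 0) →
    ∃ F ⊆ S, Forest ends F ∧ ∀ u, pdeg ends F u = t u := by
  induction S using Finset.induction_on with
  | empty =>
    intro t ht
    refine ⟨∅, subset_rfl, forest_empty, fun u => ?_⟩
    have := ht (Pi.single u 1) (by simp)
    simpa [pdeg, Pi.single_apply, eq_comm] using this
  | insert e S heS ih =>
    intro t ht
    by_cases h : ∀ χ : V → ZMod 2, (∀ e ∈ S, cob ends χ e = 0) → ∑ u, χ u * t u = 0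
    · obtain ⟨F, h1, h2, h3⟩ := ih t h
      exact ⟨F, h1.trans (Finset.subset_insert _ _), h2, h3⟩
    · push Not at h
      obtain ⟨ψ, hψ, hψt⟩ := h
      have hψt := zmod_two_eq_one hψt
      have hψe : cob ends ψ e = 1 := by
        apply zmod_two_eq_one
        intro h0
        have := ht ψ (by simpa [h0] using hψ)
        rw [hψt] at this
        exact one_ne_zero this
      obtain ⟨F, h1, h2, h3⟩ := ih (fun u => t u + inc ends e u) (by
        intro χ hχ
        have hsum : ∑ u, χ u * (t u + inc ends e u) = ∑ u, χ u * t u + cob ends χ e := by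
          simp [mul_add, Finset.sum_add_distrib, cob]
        rw [hsum]
        rcases zmod_two_cases (cob ends χ e) with h0 | h0
        · rw [h0, add_zero]
          exact ht χ (by simpa [h0] using hχ)
        · have := ht (χ + ψ) (by
            intro e' he'
            rw [cob_add]
            rcases Finset.mem_insert.1 he' with rfl | he'
            · rw [h0, hψe]; exact zmod_two_add_self 1
            · rw [hχ _ he', hψ _ he', add_zero])
          simp only [Pi.add_apply, add_mul, Finset.sum_add_distrib, hψt] at this
          rw [h0]; exact this)
      have heF : e ∉ F := fun h => heS (h1 h)
      refine ⟨insert e F, Finset.insert_subset_insert _ h1, ?_, fun u => ?_⟩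
      · intro e' he'
        rcases Finset.mem_insert.1 he' with rfl | he'
        · refine ⟨ψ, hψe, fun e'' h'' hne => ?_⟩
          exact hψ _ (h1 (Finset.mem_of_mem_insert_of_ne h'' hne))
        · obtain ⟨χ, g1, g2⟩ := h2 e' he'
          have key : ∀ x : ZMod 2, cob ends (x • ψ + χ) e = x + cob ends χ e ∧
              ∀ e'' ∈ F, cob ends (x • ψ + χ) e'' = cob ends χ e'' := by
            intro x
            rcases zmod_two_cases x with rfl | rfl
            · simp
            · simp only [one_smul, cob_add, hψe, true_and]
              intro e'' h''
              rw [hψ _ (h1 h''), zero_add]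
          obtain ⟨k1, k2⟩ := key (cob ends χ e)
          refine ⟨_, (k2 e' he').trans g1, fun e'' h'' hne => ?_⟩
          rcases Finset.mem_insert.1 h'' with rfl | h''
          · rw [k1, zmod_two_add_self]
          · rw [k2 _ h'', g2 _ h'' hne]
      · rw [pdeg_insert heF, h3, add_comm, add_assoc, zmod_two_add_self, add_zero]

/-- Local constraints that are invariant under swapping the two colors can be satisfied
simultaneously along a forest. -/
theorem Forest.exists_coloring (hl : ∀ e, ¬ (ends e).IsDiag) {F : Finset E} :
    Forest ends F → ∀ (D : V → Set E) (P : V → (E → Bool) → Prop),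
    (∀ u u' e, u ≠ u' → e ∈ D u → e ∈ D u' → e ∈ F) →
    (∀ u e, e ∈ D u → e ∈ F → u ∈ ends e) →
    (∀ u c c', (∀ e ∈ D u, c e = c' e) → P u c → P u c') →
    (∀ u c, P u c → P u (fun e => !c e)) →
    (∀ u, ∃ c, P u c) → ∃ c, ∀ u, P u c := by
  induction F using Finset.induction_on with
  | empty =>
    intro _ D P hshare _ hloc _ hne
    choose c hc using hne
    classical
    refine ⟨fun e => if h : ∃ u, e ∈ D u then c h.choose e else true, fun u => ?_⟩
    refine hloc u (c u) _ (fun e he => ?_) (hc u)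
    have h : ∃ u, e ∈ D u := ⟨u, he⟩
    rw [dif_pos h]
    by_contra hcon
    have : u ≠ h.choose := by
      intro heq; rw [← heq] at hcon; exact hcon rfl
    simpa using hshare u h.choose e this he h.choose_spec
  | insert e F heF ih =>
    intro hF D P hshare hinc hloc hflip hne
    obtain ⟨χ, hχe, hχ⟩ := hF e (Finset.mem_insert_self _ _)
    obtain ⟨a, b, hab, ha, hb⟩ : ∃ a b, ends e = s(a, b) ∧ χ a = 1 ∧ χ b = 0 := by
      obtain ⟨a, b, hab⟩ := exists_ends (ends := ends) e
      rw [cob_eq hl _ hab] at hχe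
      rcases zmod_two_cases (χ a) with h | h <;> rcases zmod_two_cases (χ b) with h' | h'
      · simp [h, h'] at hχe
      · exact ⟨b, a, hab.trans Sym2.eq_swap, h', h⟩
      · exact ⟨a, b, hab, h, h'⟩
      · rw [h, h', zmod_two_add_self] at hχe; simp at hχe
    obtain ⟨c, hc⟩ := ih (hF.mono (Finset.subset_insert _ _)) (fun u => D u \ {e})
      (fun u c => ∃ x, P u (Function.update c e x))
      (by
        intro u u' e' hne h1 h2
        exact Finset.mem_of_mem_insert_of_ne (hshare u u' e' hne h1.1 h2.1) h1.2)
      (fun u e' h1 h2 => hinc u e' h1.1 (Finset.mem_insert_of_mem h2))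
      (by
        rintro u c c' h ⟨x, hx⟩
        refine ⟨x, hloc u _ _ (fun e' he' => ?_) hx⟩
        by_cases hee : e' = e
        · subst hee; simp
        · simp [hee, h e' ⟨he', hee⟩])
      (by
        rintro u c ⟨x, hx⟩
        refine ⟨!x, hloc u _ _ (fun e' he' => ?_) (hflip u _ hx)⟩
        by_cases hee : e' = e
        · subst hee; simp
        · simp [hee])
      (fun u => (hne u).imp fun c hc => ⟨c e, by simpa using hc⟩)
    choose x hx using hc
    have hD : ∀ u, u ≠ a → u ≠ b → e ∉ D u := by
      intro u h1 h2 he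
      have := hinc u e he (Finset.mem_insert_self _ _)
      rw [hab, Sym2.mem_iff] at this
      tauto
    by_cases hxx : x a = x b
    · refine ⟨Function.update c e (x a), fun u => ?_⟩
      by_cases hua : u = a
      · exact hua ▸ hx a
      by_cases hub : u = b
      · rw [hub, hxx]; exact hx b
      refine hloc u _ _ (fun e' he' => ?_) (hx u)
      have : e' ≠ e := by rintro rfl; exact hD u hua hub he'
      simp [this]
    · classical
      refine ⟨Function.update (fun e' => if ∃ u, χ u = 1 ∧ e' ∈ D u then !c e' else c e') e (x b),
        fun u => ?_⟩
      rcases zmod_two_cases (χ u) with hu | hu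
      · refine hloc u _ _ (fun e' he' => ?_) (hx u)
        by_cases hee : e' = e
        · subst hee
          have hua : u ≠ a := by rintro rfl; simp [ha] at hu
          have hub : u = b := by
            by_contra hub; exact hD u hua hub he'
          simp [hub]
        · have : ¬ ∃ u, χ u = 1 ∧ e' ∈ D u := by
            rintro ⟨u', hu', h'⟩
            have huu : u ≠ u' := by rintro rfl; simp [hu] at hu'
            have hm := hshare u u' e' huu he' h'
            have := hχ e' hm hee
            rw [cob_of_mem hl χ (hinc _ _ he' hm) (hinc _ _ h' hm) huu, hu, hu'] at this
            simp at this
          simp [hee, this]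
      · refine hloc u _ _ (fun e' he' => ?_) (hflip u _ (hx u))
        by_cases hee : e' = e
        · subst hee
          have hub : u ≠ b := by rintro rfl; simp [hb] at hu
          have hua : u = a := by
            by_contra hua; exact hD u hua hub he'
          simp only [Function.update_self, hua]
          revert hxx
          cases x a <;> cases x b <;> simp
        · have : ∃ u, χ u = 1 ∧ e' ∈ D u := ⟨u, hu, he'⟩
          simp [hee, this]

theorem exists_validAt (X : Finset E) (u : V) : ∃ c, ValidAt ends X c u := by
  rcases zmod_two_cases (pdeg ends X u) with h | h
  · by_cases hX : ∀ e ∈ X, u ∉ ends e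
    · exact ⟨fun _ => true, Or.inl fun e he => hX e (Finset.mem_filter.1 he).1,
        Or.inl fun e he => hX e (Finset.mem_filter.1 he).1⟩
    · push Not at hX
      obtain ⟨g, hg, hu⟩ := hX
      refine ⟨fun e' => decide (e' = g), validAt_of_pdeg h ?_⟩
      have : X.filter (fun e => decide (e = g) = true) = {g} := by
        ext e; simp only [decide_eq_true_eq, Finset.mem_filter, Finset.mem_singleton]
        constructor
        · exact fun h => h.2
        · rintro rfl; exact ⟨hg, rfl⟩
      rw [this]
      simp [pdeg, inc_of_mem hu]
  · exact ⟨fun _ => true, Or.inr (by simpa using h), Or.inl (by simp)⟩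

/-- Local constraints at the vertices of `W`, on a forest together with edges that have at most
one end in `W`. -/
theorem Forest.exists_coloring_on (hl : ∀ e, ¬ (ends e).IsDiag) {F X : Finset E}
    (hF : Forest ends F) (W : Set V)
    (hhalf : ∀ e ∈ X, e ∉ F → ∀ u ∈ W, ∀ u' ∈ W, u ∈ ends e → u' ∈ ends e → u = u')
    (P : V → (E → Bool) → Prop)
    (hloc : ∀ u ∈ W, ∀ c c', (∀ e ∈ X, u ∈ ends e → c e = c' e) → P u c → P u c')
    (hflip : ∀ u ∈ W, ∀ c, P u c → P u (fun e => !c e))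
    (hne : ∀ u ∈ W, ∃ c, P u c) : ∃ c, ∀ u ∈ W, P u c := by
  refine hF.exists_coloring hl (fun u => {e | u ∈ W ∧ e ∈ X ∧ u ∈ ends e})
    (fun u c => u ∈ W → P u c) ?_ (fun u e h _ => h.2.2) ?_ (fun u c h hu => hflip u hu c (h hu)) ?_
  · intro u u' e hne h h'
    by_contra he
    exact hne (hhalf e h.2.1 he u h.1 u' h'.1 h.2.2 h'.2.2)
  · exact fun u c c' h hP hu => hloc u hu c c' (fun e he hue => h e ⟨hu, he, hue⟩) (hP hu)
  · intro u
    by_cases hu : u ∈ W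
    · exact (hne u hu).imp fun c hc _ => hc
    · exact ⟨fun _ => true, fun h => absurd h hu⟩

theorem Forest.exists_validAt (hl : ∀ e, ¬ (ends e).IsDiag) {F X : Finset E}
    (hF : Forest ends F) (W : Set V)
    (hhalf : ∀ e ∈ X, e ∉ F → ∀ u ∈ W, ∀ u' ∈ W, u ∈ ends e → u' ∈ ends e → u = u') :
    ∃ c, ∀ u ∈ W, ValidAt ends X c u :=
  hF.exists_coloring_on hl W hhalf (fun u c => ValidAt ends X c u)
    (fun _ _ _ _ h hV => hV.congr (fun _ _ => Iff.rfl) fun e he hX => h e hX he)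
    (fun _ _ _ h => h.flip) (fun u _ => OddColoring.exists_validAt X u)

theorem Good.of_validAt {X H : Finset E} {c : E → Bool} (hXH : Disjoint X H)
    (hX : ∀ u, ValidAt ends X c u) (hH : ∀ u, OddAt ends H u)
    (hcard : (Finset.univ \ (X ∪ H)).card ≤ 1) : Good ends := by
  refine ⟨X.filter (fun e => c e = true), X.filter (fun e => c e = false), H, ?_,
    Finset.disjoint_of_subset_left (Finset.filter_subset _ _) hXH,
    Finset.disjoint_of_subset_left (Finset.filter_subset _ _) hXH,
    fun u => (hX u).1, fun u => (hX u).2, hH, ?_⟩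
  · rw [Finset.disjoint_left]
    intro e h1 h2
    simp only [Finset.mem_filter] at h1 h2
    simp [h1.2] at h2
  · have : X.filter (fun e => c e = true) ∪ X.filter (fun e => c e = false) = X := by
      ext e; simp only [Finset.mem_union, Finset.mem_filter]
      cases c e <;> simp
    rwa [this]

/-- The edges at `v`. -/
def edgesAt (ends : E → Sym2 V) (v : V) : Finset E := Finset.univ.filter fun e => v ∈ ends e

/-- The edges that avoid `v`. -/
def edgesOff (ends : E → Sym2 V) (v : V) : Finset E := Finset.univ.filter fun e => v ∉ ends e

@[simp] theorem mem_edgesAt {v : V} {e : E} : e ∈ edgesAt ends v ↔ v ∈ ends e := by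
  simp [edgesAt]

@[simp] theorem mem_edgesOff {v : V} {e : E} : e ∈ edgesOff ends v ↔ v ∉ ends e := by
  simp [edgesOff]

/-- `F` meets every vertex other than `v` in a parity opposite to that of `G - v`. -/
def IsJoin (ends : E → Sym2 V) (v : V) (F : Finset E) : Prop :=
  F ⊆ edgesOff ends v ∧ ∀ u, u ≠ v → pdeg ends F u = pdeg ends (edgesOff ends v) u + 1

theorem pdeg_edgesOff_self (v : V) : pdeg ends (edgesOff ends v) v = 0 :=
  pdeg_eq_zero fun _ he => mem_edgesOff.1 he

theorem pdeg_edgesOff_add (v u : V) :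
    pdeg ends (edgesOff ends v) u + pdeg ends (edgesAt ends v) u = pdeg ends Finset.univ u := by
  rw [← pdeg_union]
  · congr 1; ext e; simp [em']
  · rw [Finset.disjoint_left]; intro _; simp

theorem pdeg_edgesAt_self (v : V) : pdeg ends (edgesAt ends v) v = pdeg ends Finset.univ v := by
  rw [← pdeg_edgesOff_add v v, pdeg_edgesOff_self, zero_add]

theorem IsJoin.oddAt_sdiff {v : V} {F : Finset E} (hF : IsJoin ends v F) (u : V) :
    OddAt ends (edgesOff ends v \ F) u := by
  by_cases hu : u = v
  · subst hu
    exact Or.inl fun e he => mem_edgesOff.1 (Finset.mem_sdiff.1 he).1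
  · right
    rw [pdeg_sdiff hF.1, hF.2 u hu, ← add_assoc, zmod_two_add_self, zero_add]

theorem IsJoin.good {v : V} {F₀ F : Finset E} (hF₀ : IsJoin ends v F₀) (hF : F ⊆ F₀)
    (hcard : (F₀ \ F).card ≤ 1) {c : E → Bool} (hc : ∀ u, ValidAt ends (F ∪ edgesAt ends v) c u) :
    Good ends := by
  refine Good.of_validAt (H := edgesOff ends v \ F₀) ?_ hc hF₀.oddAt_sdiff ?_
  · rw [Finset.disjoint_left]
    intro e h1 h2
    simp only [Finset.mem_union, Finset.mem_sdiff, mem_edgesAt, mem_edgesOff] at h1 h2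
    exact h1.elim (fun h => h2.2 (hF h)) h2.1
  · refine (Finset.card_le_card fun e => ?_).trans hcard
    simp only [Finset.mem_union, Finset.mem_sdiff, mem_edgesAt, mem_edgesOff, Finset.mem_univ]
    tauto

theorem sum_one_eq : (∑ _u : V, (1 : ZMod 2)) = (Fintype.card V : ZMod 2) := by simp

theorem good_of_even (hl : ∀ e, ¬ (ends e).IsDiag)
    (hconn : ∀ χ : V → ZMod 2, (∀ e, cob ends χ e = 0) → ∀ u w, χ u = χ w)
    (hn : (Fintype.card V : ZMod 2) = 0) : Good ends := by
  obtain ⟨F, -, hF, hFt⟩ := exists_join (ends := ends) Finset.univ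
    (fun u => pdeg ends Finset.univ u + 1) (by
      intro χ hχ
      simp only [mul_add, Finset.sum_add_distrib, handshake, mul_one]
      rw [Finset.sum_eq_zero hχ, zero_add]
      by_cases hV : Nonempty V
      · obtain ⟨v⟩ := hV
        rw [Finset.sum_congr rfl fun u _ => hconn χ (fun e => hχ e (Finset.mem_univ _)) u v]
        simp [hn]
      · simp [not_nonempty_iff.1 hV])
  obtain ⟨c, hc⟩ := hF.exists_validAt hl (X := F) Set.univ (fun _ h h' => absurd h h')
  refine Good.of_validAt (H := Finset.univ \ F) Finset.disjoint_sdiff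
    (fun u => hc u trivial) (fun u => Or.inr ?_)
    (by rw [Finset.union_sdiff_of_subset (Finset.subset_univ _)]; simp)
  rw [pdeg_sdiff (Finset.subset_univ _), hFt, ← add_assoc, zmod_two_add_self, zero_add]

theorem cob_eq_zero_iff (hl : ∀ e, ¬ (ends e).IsDiag) {χ : V → ZMod 2} {e : E} {a b : V}
    (h : ends e = s(a, b)) : cob ends χ e = 0 ↔ χ a = χ b := by
  rw [cob_eq hl χ h]
  generalize χ a = x; generalize χ b = y
  revert x y; decide

theorem eq_of_cob_eq_zero (hl : ∀ e, ¬ (ends e).IsDiag) {χ : V → ZMod 2} {e : E} {a b : V}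
    (h : cob ends χ e = 0) (ha : a ∈ ends e) (hb : b ∈ ends e) : χ a = χ b := by
  by_cases hab : a = b
  · rw [hab]
  · exact (cob_eq_zero_iff hl ((Sym2.mem_and_mem_iff hab).1 ⟨ha, hb⟩)).1 h

theorem cob_const_one (hl : ∀ e, ¬ (ends e).IsDiag) (e : E) : cob ends (fun _ => 1) e = 0 := by
  obtain ⟨a, b, h⟩ := exists_ends (ends := ends) e
  exact (cob_eq_zero_iff hl h).2 rfl

theorem cob_mul_eq_zero (hl : ∀ e, ¬ (ends e).IsDiag) {χ ψ : V → ZMod 2} {e : E}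
    (h : cob ends χ e = 0) (h' : cob ends ψ e = 0) : cob ends (χ * ψ) e = 0 := by
  obtain ⟨a, b, hab⟩ := exists_ends (ends := ends) e
  rw [cob_eq_zero_iff hl hab] at *
  simp [h, h']

/-- If the edges of `S` that cross the cut `d` form a star at `v`, then `S` splits into three odd
subgraphs as soon as the required join exists on the remaining edges. -/
theorem good_of_star_cut (hl : ∀ e, ¬ (ends e).IsDiag) {S K : Finset E} {d : V → ZMod 2} {v : V}
    (hv : d v = 0) (hK : ∀ e, e ∈ K ↔ e ∈ S ∧ cob ends d e = 1) (hKv : ∀ e ∈ K, v ∈ ends e)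
    (hodd : pdeg ends K v = 1)
    (hS : ∀ χ : V → ZMod 2, (∀ e ∈ S, e ∉ K → cob ends χ e = 0) →
      ∑ u, χ u * (1 + d u * pdeg ends K u) = 0)
    (hcard : (Finset.univ \ S).card ≤ 1) : Good ends := by
  have hKS : K ⊆ S := fun e he => ((hK e).1 he).1
  have hcob : ∀ e ∈ S \ K, cob ends d e = 0 := by
    intro e he
    rw [Finset.mem_sdiff, hK] at he
    rcases zmod_two_cases (cob ends d e) with h | h
    · exact h
    · exact absurd ⟨he.1, h⟩ he.2
  obtain ⟨F, hFS, hF, hFt⟩ := exists_join (ends := ends) (S \ K)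
    (fun u => pdeg ends (S \ K) u + (1 + d u * pdeg ends K u)) (by
      intro χ hχ
      simp only [mul_add (χ _) _ (1 + _), Finset.sum_add_distrib, handshake]
      rw [Finset.sum_eq_zero hχ, zero_add]
      exact hS χ fun e he he' => hχ e (Finset.mem_sdiff.2 ⟨he, he'⟩))
  obtain ⟨g, hg⟩ : ∃ g, g ∈ K := by
    by_contra h
    push Not at h
    rw [pdeg_eq_zero fun e he => absurd he (h e)] at hodd
    exact zero_ne_one hodd
  have hgF : g ∉ F := fun h => (Finset.mem_sdiff.1 (hFS h)).2 hg
  have hgv : ∀ u, u ∈ ends g → d u = 0 → u = v := by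
    intro u hu hdu
    by_contra hne
    have := cob_of_mem hl d hu (hKv g hg) hne
    rw [((hK g).1 hg).2, hdu, hv] at this
    simp at this
  obtain ⟨c, hcg, hc1, hc0⟩ : ∃ c : E → Bool, c g = true ∧
      (∀ u, d u = 1 → ValidAt ends F c u) ∧ ∀ u, d u = 0 → ValidAt ends (insert g F) c u := by
    obtain ⟨c, hc⟩ := hF.exists_coloring hl
      (fun u => {e | u ∈ ends e ∧ (e ∈ F ∨ d u = 0 ∧ e = g)})
      (fun u c => (d u = 1 → ValidAt ends F c u) ∧ (d u = 0 → ValidAt ends (insert g F) c u))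
      (by
        rintro u u' e hne ⟨hu, h⟩ ⟨hu', h'⟩
        by_contra heF
        obtain ⟨h1, rfl⟩ := h.resolve_left heF
        obtain ⟨h2, -⟩ := h'.resolve_left heF
        exact hne ((hgv u hu h1).trans (hgv u' hu' h2).symm))
      (fun u e h _ => h.1)
      (by
        intro u c c' h hP
        refine ⟨fun hu => (hP.1 hu).congr (fun _ _ => Iff.rfl) fun e he hX => h e ⟨he, Or.inl hX⟩,
          fun hu => (hP.2 hu).congr (fun _ _ => Iff.rfl) fun e he hX => h e ⟨he, ?_⟩⟩
        rcases Finset.mem_insert.1 hX with rfl | hX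
        · exact Or.inr ⟨hu, rfl⟩
        · exact Or.inl hX)
      (fun u c h => ⟨fun hu => (h.1 hu).flip, fun hu => (h.2 hu).flip⟩)
      (by
        intro u
        rcases zmod_two_cases (d u) with h | h
        · obtain ⟨c, hc⟩ := exists_validAt (ends := ends) (insert g F) u
          exact ⟨c, by simp [h], fun _ => hc⟩
        · obtain ⟨c, hc⟩ := exists_validAt (ends := ends) F u
          exact ⟨c, fun _ => hc, by simp [h]⟩)
    cases hcg : c g with
    | true => exact ⟨c, hcg, fun u => (hc u).1, fun u => (hc u).2⟩
    | false =>
      exact ⟨fun e => !c e, by simp [hcg], fun u hu => ((hc u).1 hu).flip,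
        fun u hu => ((hc u).2 hu).flip⟩
  have hFS' : ∀ e ∈ F, e ∈ S ∧ e ∉ K := fun e he => Finset.mem_sdiff.1 (hFS he)
  classical
  obtain ⟨ins, hins_iff⟩ : ∃ ins : E → Prop,
      ∀ e ∈ S, e ∉ K → ∀ u ∈ ends e, (ins e ↔ d u = 1) := by
    refine ⟨fun e => ∃ u ∈ ends e, d u = 1, ?_⟩
    intro e he he' u hu
    refine ⟨?_, fun h => ⟨u, hu, h⟩⟩
    rintro ⟨w, hw, hdw⟩
    rw [eq_of_cob_eq_zero hl (hcob e (Finset.mem_sdiff.2 ⟨he, he'⟩)) hu hw, hdw]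
  have hKins : ∀ e ∈ K, ∀ u ∈ ends e, d u = 0 → u = v := by
    intro e he u hu hdu
    by_contra hne
    have := cob_of_mem hl d hu (hKv e he) hne
    rw [((hK e).1 he).2, hdu, hv] at this
    simp at this
  refine ⟨S.filter fun e => e ∈ K ∨ (ins e ∧ e ∉ F) ∨ (¬ ins e ∧ e ∈ F ∧ c e = true),
    (S \ K).filter fun e => (ins e ∧ e ∈ F ∧ c e = true) ∨ (¬ ins e ∧ e ∉ F),
    F.filter fun e => c e = false, ?_, ?_, ?_, ?_, ?_, ?_, ?_⟩
  · rw [Finset.disjoint_left]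
    intro e h1 h2
    simp only [Finset.mem_filter, Finset.mem_sdiff] at h1 h2
    tauto
  · rw [Finset.disjoint_left]
    intro e h1 h2
    simp only [Finset.mem_filter] at h1 h2
    have := hFS' e h2.1
    simp [h2] at h1
    tauto
  · rw [Finset.disjoint_left]
    intro e h1 h2
    simp only [Finset.mem_filter, Finset.mem_sdiff] at h1 h2
    have := hFS' e h2.1
    simp [h2] at h1
  · intro u
    rcases zmod_two_cases (d u) with hu | hu
    · by_cases huv : u = v
      · subst huv
        right
        have h1 : pdeg ends (K ∪ F.filter fun e => c e = true) u = 1 := by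
          rw [pdeg_union, hodd]
          · rcases (hc0 u hu).1 with h | h
            · exact absurd (hKv g hg) (h g (by simp [hcg]))
            · rw [Finset.filter_insert, if_pos hcg, pdeg_insert (by simp [hgF]),
                inc_of_mem (hKv g hg)] at h
              exact h
          · rw [Finset.disjoint_left]
            intro e h1 h2
            exact (hFS' e (Finset.mem_filter.1 h2).1).2 h1
        rw [← h1]
        refine pdeg_congr fun e he => ?_
        have h3 := hins_iff e
        have h4 := hFS' e
        have h5 := @hKS e
        simp only [Finset.mem_filter, Finset.mem_union]
        by_cases heK : e ∈ K
        · simp [heK, h5 heK]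
        · by_cases heS : e ∈ S
          · have := h3 heS heK u he
            simp [this, hu, heS]
          · have : e ∉ F := fun h => heS (h4 h).1
            simp [heK, heS, this]
      · refine (hc0 u hu).1.congr fun e he => ?_
        have h3 := hins_iff e
        have h4 := hFS' e
        simp only [Finset.mem_filter, Finset.mem_insert]
        have heg : e ≠ g := by rintro rfl; exact huv (hgv u he hu)
        have heK : e ∉ K := fun h => huv (hKins e h u he hu)
        by_cases heS : e ∈ S
        · have := h3 heS heK u he
          simp [this, hu, heS, heg, heK]
        · have : e ∉ F := fun h => heS (h4 h).1
          simp [heg, heS, this]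
    · right
      have h1 : pdeg ends (S \ F) u = 1 := by
        rw [pdeg_sdiff fun e he => (hFS' e he).1, hFt, pdeg_sdiff hKS, hu]
        generalize pdeg ends S u = x; generalize pdeg ends K u = y
        revert x y; decide
      rw [← h1]
      refine pdeg_congr fun e he => ?_
      have h3 := hins_iff e
      have h4 := hFS' e
      simp only [Finset.mem_filter, Finset.mem_sdiff]
      by_cases heS : e ∈ S
      · by_cases heK : e ∈ K
        · have : e ∉ F := fun h => (h4 h).2 heK
          simp [heS, heK, this]
        · have := h3 heS heK u he
          simp [this, hu, heS, heK]
      · simp [heS]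
  · intro u
    rcases zmod_two_cases (d u) with hu | hu
    · right
      have h1 : pdeg ends ((S \ K) \ F) u = 1 := by
        rw [pdeg_sdiff hFS, hFt, hu]
        generalize pdeg ends (S \ K) u = x
        revert x; simp; decide
      rw [← h1]
      refine pdeg_congr fun e he => ?_
      have h3 := hins_iff e
      simp only [Finset.mem_filter, Finset.mem_sdiff]
      by_cases hSK : e ∈ S ∧ e ∉ K
      · have := h3 hSK.1 hSK.2 u he
        simp [this, hu, hSK]
      · tauto
    · refine (hc1 u hu).1.congr fun e he => ?_
      have h3 := hins_iff e
      have h4 := hFS' e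
      simp only [Finset.mem_filter, Finset.mem_sdiff]
      by_cases hSK : e ∈ S ∧ e ∉ K
      · have := h3 hSK.1 hSK.2 u he
        simp [this, hu, hSK]
      · tauto
  · intro u
    rcases zmod_two_cases (d u) with hu | hu
    · have := (hc0 u hu).2
      rwa [Finset.filter_insert, if_neg (by simp [hcg])] at this
    · exact (hc1 u hu).2
  · refine (Finset.card_le_card fun e => ?_).trans hcard
    have h4 := hFS' e
    simp only [Finset.mem_sdiff, Finset.mem_union, Finset.mem_filter, Finset.mem_univ]
    cases c e <;> simp <;> tauto

/-- Connectedness, expressed through cuts. -/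
def Conn (ends : E → Sym2 V) : Prop :=
  ∀ χ : V → ZMod 2, (∀ e, cob ends χ e = 0) → ∀ u w, χ u = χ w

theorem exists_minimal_support {P : (V → ZMod 2) → Prop} (h : ∃ χ, P χ) :
    ∃ χ, P χ ∧ ∀ ψ, P ψ → (∀ u, χ u = 0 → ψ u = 0) → ψ = χ := by
  classical
  obtain ⟨χ₀, h₀⟩ := h
  obtain ⟨χ, hχ, hmin⟩ := Finset.exists_min_image (Finset.univ.filter P)
    (fun χ => (Finset.univ.filter fun u => χ u ≠ 0).card) ⟨χ₀, by simpa using h₀⟩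
  simp only [Finset.mem_filter, Finset.mem_univ, true_and] at hχ hmin
  refine ⟨χ, hχ, fun ψ hψ hsub => ?_⟩
  have hss : (Finset.univ.filter fun u => ψ u ≠ 0) ⊆ (Finset.univ.filter fun u => χ u ≠ 0) := by
    intro u
    simp only [Finset.mem_filter, Finset.mem_univ, true_and]
    exact fun h h' => h (hsub u h')
  have heq := Finset.eq_of_subset_of_card_le hss (hmin ψ hψ)
  funext u
  have := Finset.ext_iff.1 heq u
  simp only [Finset.mem_filter, Finset.mem_univ, true_and] at this
  rcases zmod_two_cases (ψ u) with h1 | h1 <;> rcases zmod_two_cases (χ u) with h2 | h2 <;>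
    simp_all

theorem sum_star (χ d : V → ZMod 2) (K : Finset E) :
    ∑ u, χ u * (1 + d u * pdeg ends K u) = ∑ u, χ u + ∑ e ∈ K, cob ends (χ * d) e := by
  rw [← handshake, ← Finset.sum_add_distrib]
  refine Finset.sum_congr rfl fun u _ => ?_
  simp only [Pi.mul_apply]; ring

theorem sum_star_add (χ ψ f : V → ZMod 2) :
    ∑ u, (χ + ψ) u * f u = ∑ u, χ u * f u + ∑ u, ψ u * f u := by
  simp [add_mul, Finset.sum_add_distrib]

theorem mul_self_fun (d : V → ZMod 2) : d * d = d := by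
  funext u
  simp only [Pi.mul_apply]
  generalize d u = x
  revert x; decide

theorem pdeg_eq_card_of_star {K : Finset E} {v : V} (h : ∀ e ∈ K, v ∈ ends e) :
    pdeg ends K v = (K.card : ZMod 2) := by
  rw [pdeg, Finset.sum_congr rfl fun e he => inc_of_mem (h e he)]
  simp

theorem sum_cob_crossing {K : Finset E} {d : V → ZMod 2} {v : V}
    (hK : ∀ e ∈ K, cob ends d e = 1) (h : ∀ e ∈ K, v ∈ ends e) :
    ∑ e ∈ K, cob ends d e = pdeg ends K v := by
  rw [Finset.sum_congr rfl hK, pdeg_eq_card_of_star h]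
  simp

theorem card_univ_sdiff_erase_le (g : E) : (Finset.univ \ Finset.univ.erase g).card ≤ 1 := by
  refine (Finset.card_le_card (t := {g}) fun e => ?_).trans (Finset.card_singleton g).le
  simp

/-- Every union of components of `G - v` has even order, unless `G` is good. -/
theorem sum_eq_zero_of_closed_off (hl : ∀ e, ¬ (ends e).IsDiag) (hconn : Conn ends)
    (hn : (Fintype.card V : ZMod 2) = 1) (hgood : ¬ Good ends) (v : V) (χ : V → ZMod 2)
    (hχv : χ v = 0) (hχ : ∀ e, v ∉ ends e → cob ends χ e = 0) : ∑ u, χ u = 0 := by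
  by_contra hsum
  obtain ⟨d, ⟨hdv, hd, hdsum⟩, hmin⟩ := exists_minimal_support (P := fun χ =>
    χ v = 0 ∧ (∀ e, v ∉ ends e → cob ends χ e = 0) ∧ ∑ u, χ u = 1)
    ⟨χ, hχv, hχ, zmod_two_eq_one hsum⟩
  have hdv' : ∀ e, cob ends d e = 1 → v ∈ ends e := by
    intro e he
    by_contra h
    rw [hd e h] at he
    exact zero_ne_one he
  obtain ⟨g, hg⟩ : ∃ g, cob ends d g = 1 := by
    by_contra h
    push Not at h
    have hc := hconn d fun e => (zmod_two_cases _).resolve_right (h e)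
    rw [Finset.sum_congr rfl fun u _ => hc u v, hdv] at hdsum
    simp at hdsum
  obtain ⟨S, K, hScard, hS, hK, hKodd⟩ : ∃ S K : Finset E, (Finset.univ \ S).card ≤ 1 ∧
      (∀ e, e ∉ S → cob ends d e = 1) ∧ (∀ e, e ∈ K ↔ e ∈ S ∧ cob ends d e = 1) ∧
      pdeg ends K v = 1 := by
    rcases zmod_two_cases (pdeg ends (Finset.univ.filter fun e => cob ends d e = 1) v) with h | h
    · refine ⟨Finset.univ.erase g, (Finset.univ.filter fun e => cob ends d e = 1).erase g,
        ?_, ?_, by simp, ?_⟩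
      · exact card_univ_sdiff_erase_le g
      · intro e he
        have : e = g := by simpa using he
        rw [this, hg]
      · rw [pdeg_erase (by simp [hg]), h, inc_of_mem (hdv' g hg), add_zero]
    · exact ⟨Finset.univ, _, by simp, by simp, by simp, h⟩
  have hKc : ∀ e ∈ K, cob ends d e = 1 := fun e he => ((hK e).1 he).2
  have hKv : ∀ e ∈ K, v ∈ ends e := fun e he => hdv' e (hKc e he)
  refine hgood (good_of_star_cut hl hdv hK hKv hKodd ?_ hScard)
  have hLd : ∑ u, d u * (1 + d u * pdeg ends K u) = 0 := by
    rw [sum_star, mul_self_fun, hdsum, sum_cob_crossing hKc hKv, hKodd]; exact zmod_two_add_self 1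
  have hL1 : ∑ u, (1 : V → ZMod 2) u * (1 + d u * pdeg ends K u) = 0 := by
    rw [sum_star, one_mul, sum_cob_crossing hKc hKv, hKodd]
    simp only [Pi.one_apply]
    rw [sum_one_eq, hn]; exact zmod_two_add_self 1
  have hmain : ∀ χ : V → ZMod 2, (∀ e ∈ S, e ∉ K → cob ends χ e = 0) → χ v = 0 →
      ∑ u, χ u * (1 + d u * pdeg ends K u) = 0 := by
    intro χ hχ hχv
    have hχ' : ∀ e, cob ends d e = 0 → cob ends χ e = 0 := by
      intro e he
      refine hχ e ?_ fun h => ?_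
      · by_contra h
        rw [hS e h] at he; exact one_ne_zero he
      · rw [hKc e h] at he; exact one_ne_zero he
    have h1 : χ * d = 0 ∨ χ * d = d := by
      have hcl : ∀ e, v ∉ ends e → cob ends (χ * d) e = 0 := fun e he =>
        cob_mul_eq_zero hl (hχ' e (hd e he)) (hd e he)
      rcases zmod_two_cases (∑ u, (χ * d) u) with h | h
      · left
        have := hmin (d + χ * d) ⟨by simp [hdv],
          fun e he => by rw [cob_add, hd e he, hcl e he, add_zero],
          by simp only [Pi.add_apply, Finset.sum_add_distrib]; rw [h, hdsum, add_zero]⟩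
          (fun u hu => by simp [hu])
        simpa using this
      · right
        exact hmin _ ⟨by simp [hdv], hcl, h⟩ fun u hu => by simp [hu]
    have h2 : χ + χ * d = 0 := by
      funext u
      have h3 : (χ + χ * d) v = 0 := by simp [hχv]
      rw [Pi.zero_apply, ← h3]
      refine hconn _ (fun e => ?_) u v
      rcases zmod_two_cases (cob ends d e) with he | he
      · rw [cob_add, hχ' e he, cob_mul_eq_zero hl (hχ' e he) he, add_zero]
      · obtain ⟨x, hx⟩ := hdv' e he
        rw [cob_eq hl _ hx, h3, zero_add]
        rw [cob_eq hl _ hx, hdv, zero_add] at he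
        simp [he, zmod_two_add_self]
    have h3 : χ = χ * d := by
      funext u
      have := congrFun h2 u
      simp only [Pi.add_apply, Pi.zero_apply] at this
      generalize (χ * d) u = y at *
      generalize χ u = x at *
      revert x y; decide
    rcases h1 with h1 | h1
    · rw [h3, h1]; simp
    · rw [h3, h1]; exact hLd
  intro χ hχ
  rcases zmod_two_cases (χ v) with h | h
  · exact hmain χ hχ h
  · have := hmain (χ + 1) (fun e he he' => by
      rw [cob_add, hχ e he he', zero_add]; exact cob_const_one hl e) (by simp [h]; decide)
    rwa [sum_star_add, hL1, add_zero] at this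

theorem exists_cob_eq_one {χ : V → ZMod 2} (hl : ∀ e, ¬ (ends e).IsDiag) {e : E}
    (h : cob ends χ e = 1) : ∃ a b, ends e = s(a, b) ∧ χ a = 1 ∧ χ b = 0 := by
  obtain ⟨a, b, hab⟩ := exists_ends (ends := ends) e
  rw [cob_eq hl _ hab] at h
  rcases zmod_two_cases (χ a) with h1 | h1 <;> rcases zmod_two_cases (χ b) with h2 | h2
  · simp [h1, h2] at h
  · exact ⟨b, a, hab.trans Sym2.eq_swap, h2, h1⟩
  · exact ⟨a, b, hab, h1, h2⟩
  · rw [h1, h2, zmod_two_add_self] at h; simp at h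

/-- `G` has no bridge, unless it is good. -/
theorem no_bridge (hl : ∀ e, ¬ (ends e).IsDiag) (hconn : Conn ends)
    (hn : (Fintype.card V : ZMod 2) = 1) (hgood : ¬ Good ends) (χ : V → ZMod 2) (f : E)
    (hχ : ∀ e, e ≠ f → cob ends χ e = 0) : cob ends χ f = 0 := by
  by_contra hf
  obtain ⟨a, b, hab, ha, hb⟩ := exists_cob_eq_one hl (zmod_two_eq_one hf)
  have h1 := sum_eq_zero_of_closed_off hl hconn hn hgood b χ hb fun e he =>
    hχ e (by rintro rfl; simp [hab] at he)
  have h2 := sum_eq_zero_of_closed_off hl hconn hn hgood a (χ + 1) (by simp [ha]; decide)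
    fun e he => by
      rw [cob_add, hχ e (by rintro rfl; simp [hab] at he), zero_add]
      exact cob_const_one hl e
  simp only [Pi.add_apply, Finset.sum_add_distrib, h1, Pi.one_apply, zero_add] at h2
  rw [sum_one_eq, hn] at h2
  exact one_ne_zero h2

theorem good_of_two_cut (hl : ∀ e, ¬ (ends e).IsDiag) (hconn : Conn ends)
    (hn : (Fintype.card V : ZMod 2) = 1) {χ : V → ZMod 2} {f f' : E} (hff : f' ≠ f)
    (hf' : cob ends χ f' = 1)
    (hχ : ∀ e, e ≠ f → e ≠ f' → cob ends χ e = 0) (hsum : ∑ u, χ u = 0) : Good ends := by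
  by_contra hgood
  obtain ⟨v, x, hvx, hv, hx⟩ := exists_cob_eq_one hl hf'
  have hd : ∀ e, cob ends (χ + 1) e = cob ends χ e := fun e => by
    rw [cob_add]
    exact (congrArg _ (cob_const_one hl e)).trans (add_zero _)
  have hdv : (χ + 1) v = 0 := by simp [hv]; decide
  have hdx : (χ + 1) x = 1 := by simp [hx]
  have hKodd : pdeg ends {f'} v = 1 := by
    simp only [pdeg, Finset.sum_singleton]
    exact inc_of_mem (by simp [hvx])
  have hKc : ∀ e ∈ ({f'} : Finset E), cob ends (χ + 1) e = 1 := by simp [hd, hf']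
  have hKv : ∀ e ∈ ({f'} : Finset E), v ∈ ends e := by simp [hvx]
  refine hgood (good_of_star_cut hl (S := Finset.univ.erase f) (K := {f'}) hdv ?_ hKv hKodd ?_ ?_)
  · intro e
    simp only [Finset.mem_singleton, Finset.mem_erase, Finset.mem_univ, and_true, hd]
    constructor
    · rintro rfl; exact ⟨hff, hf'⟩
    · rintro ⟨h1, h2⟩
      by_contra h3
      rw [hχ e h1 h3] at h2
      exact zero_ne_one h2
  · have hLd : ∑ u, (χ + 1) u * (1 + (χ + 1) u * pdeg ends {f'} u) = 0 := by
      rw [sum_star, mul_self_fun, sum_cob_crossing hKc hKv, hKodd]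
      simp only [Pi.add_apply, Finset.sum_add_distrib, hsum, Pi.one_apply, zero_add]
      rw [sum_one_eq, hn]; exact zmod_two_add_self 1
    have hL1 : ∑ u, (1 : V → ZMod 2) u * (1 + (χ + 1) u * pdeg ends {f'} u) = 0 := by
      rw [sum_star, one_mul, sum_cob_crossing hKc hKv, hKodd]
      simp only [Pi.one_apply]
      rw [sum_one_eq, hn]; exact zmod_two_add_self 1
    have h0 : ∀ ψ : V → ZMod 2, (∀ e, e ≠ f → e ≠ f' → cob ends ψ e = 0) → ψ v = 0 → ψ x = 0 →
        ∑ u, ψ u * (1 + (χ + 1) u * pdeg ends {f'} u) = 0 := by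
      intro ψ hψ h1 h2
      have h3 : ∀ e, e ≠ f → cob ends ψ e = 0 := by
        intro e he
        by_cases he' : e = f'
        · rw [he', cob_eq hl _ hvx, h1, h2, add_zero]
        · exact hψ e he he'
      have h4 := no_bridge hl hconn hn hgood ψ f h3
      have h5 := hconn ψ (fun e => by
        by_cases he : e = f
        · rw [he, h4]
        · exact h3 e he)
      exact Finset.sum_eq_zero fun u _ => by rw [h5 u v, h1, zero_mul]
    have h1 : ∀ ψ : V → ZMod 2, (∀ e, e ≠ f → e ≠ f' → cob ends ψ e = 0) → ψ v = 0 →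
        ∑ u, ψ u * (1 + (χ + 1) u * pdeg ends {f'} u) = 0 := by
      intro ψ hψ hψv
      rcases zmod_two_cases (ψ x) with h | h
      · exact h0 ψ hψ hψv h
      · have := h0 (ψ + (χ + 1)) (fun e he he' => by
          rw [cob_add, hψ e he he', hd, hχ e he he', add_zero])
          (by rw [Pi.add_apply, hψv, hdv, add_zero])
          (by rw [Pi.add_apply, h, hdx]; exact zmod_two_add_self 1)
        rwa [sum_star_add, hLd, add_zero] at this
    intro ψ hψ
    have hψ' : ∀ e, e ≠ f → e ≠ f' → cob ends ψ e = 0 := fun e he he' =>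
      hψ e (by simp [he]) (by simp [he'])
    rcases zmod_two_cases (ψ v) with h | h
    · exact h1 ψ hψ' h
    · have := h1 (ψ + 1) (fun e he he' => by
        rw [cob_add, hψ' e he he', zero_add]; exact cob_const_one hl e) (by simp [h]; decide)
      rwa [sum_star_add, hL1, add_zero] at this
  · exact card_univ_sdiff_erase_le f

theorem sum_eq_of_closed_off (hl : ∀ e, ¬ (ends e).IsDiag) (hconn : Conn ends)
    (hn : (Fintype.card V : ZMod 2) = 1) (hgood : ¬ Good ends) (v : V) (χ : V → ZMod 2)
    (hχ : ∀ e, v ∉ ends e → cob ends χ e = 0) : ∑ u, χ u = χ v := by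
  rcases zmod_two_cases (χ v) with h | h
  · rw [h]; exact sum_eq_zero_of_closed_off hl hconn hn hgood v χ h hχ
  · have := sum_eq_zero_of_closed_off hl hconn hn hgood v (χ + 1) (by simp [h]; decide)
      fun e he => by
        rw [cob_add, hχ e he, zero_add]; exact cob_const_one hl e
    simp only [Pi.add_apply, Finset.sum_add_distrib, Pi.one_apply] at this
    rw [sum_one_eq, hn] at this
    rw [h]
    revert this; generalize ∑ u, χ u = x
    revert x; decide

theorem exists_isJoin (hl : ∀ e, ¬ (ends e).IsDiag) (hconn : Conn ends)
    (hn : (Fintype.card V : ZMod 2) = 1) (hgood : ¬ Good ends) (v : V) :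
    ∃ F, IsJoin ends v F ∧ Forest ends F := by
  obtain ⟨F, hFS, hF, hFt⟩ := exists_join (ends := ends) (edgesOff ends v)
    (fun u => pdeg ends (edgesOff ends v) u + (1 + if u = v then 1 else 0)) (by
      intro χ hχ
      simp only [mul_add, Finset.sum_add_distrib, handshake, mul_one]
      rw [Finset.sum_eq_zero hχ, zero_add,
        sum_eq_of_closed_off hl hconn hn hgood v χ fun e he => hχ e (mem_edgesOff.2 he)]
      simp [zmod_two_add_self])
  exact ⟨F, ⟨hFS, fun u hu => by rw [hFt, if_neg hu, add_zero]⟩, hF⟩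

/-- A weight that is not identically zero can be made odd on a union of components of a forest by
deleting at most one edge. -/
theorem Forest.exists_odd_weight {F : Finset E} (hF : Forest ends F) {k : V → ZMod 2}
    (hk : k ≠ 0) : ∃ F' ⊆ F, (F \ F').card ≤ 1 ∧ ∃ χ : V → ZMod 2,
      (∀ e ∈ F', cob ends χ e = 0) ∧ ∑ u, χ u * k u = 1 := by
  by_cases h : ∃ χ : V → ZMod 2, (∀ e ∈ F, cob ends χ e = 0) ∧ ∑ u, χ u * k u = 1
  · exact ⟨F, subset_rfl, by simp, h⟩
  · push Not at h
    obtain ⟨J, hJF, -, hJ⟩ := exists_join (ends := ends) F k fun χ hχ =>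
      (zmod_two_cases _).resolve_right (h χ hχ)
    obtain ⟨e, he⟩ : J.Nonempty := by
      rw [Finset.nonempty_iff_ne_empty]
      rintro rfl
      exact hk (funext fun u => by rw [← hJ u]; rfl)
    obtain ⟨χ, h1, h2⟩ := hF e (hJF he)
    refine ⟨F.erase e, Finset.erase_subset _ _, ?_, χ, fun e' he' => ?_, ?_⟩
    · refine (Finset.card_le_card (t := {e}) fun e' => ?_).trans (Finset.card_singleton e).le
      simp only [Finset.mem_sdiff, Finset.mem_erase, Finset.mem_singleton]
      tauto
    · exact h2 e' (Finset.mem_of_mem_erase he') (Finset.ne_of_mem_erase he')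
    · simp only [← hJ]
      rw [handshake, Finset.sum_eq_single e, h1]
      · exact fun e' he' hne => h2 e' (hJF he') hne
      · exact fun h => absurd he h

theorem pdeg_filter_xor (X : Finset E) (c s : E → Bool) (u : V) :
    pdeg ends (X.filter fun e => (c e ^^ s e) = true) u =
      pdeg ends (X.filter fun e => c e = true) u + pdeg ends (X.filter fun e => s e = true) u := by
  simp only [pdeg, Finset.sum_filter]
  rw [← Finset.sum_add_distrib]
  refine Finset.sum_congr rfl fun e _ => ?_
  cases c e <;> cases s e <;> simp [zmod_two_add_self]

theorem half_of_edgesAt {F : Finset E} {v : V} : ∀ e ∈ F ∪ edgesAt ends v, e ∉ F →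
    ∀ u ∈ {u : V | u ≠ v}, ∀ u' ∈ {u : V | u ≠ v}, u ∈ ends e → u' ∈ ends e → u = u' := by
  intro e he heF u hu u' hu' h h'
  by_contra hne
  have hve : v ∈ ends e := mem_edgesAt.1 ((Finset.mem_union.1 he).resolve_left heF)
  rw [(Sym2.mem_and_mem_iff hne).1 ⟨h, h'⟩, Sym2.mem_iff] at hve
  rcases hve with rfl | rfl
  · exact hu rfl
  · exact hu' rfl

theorem disjoint_edgesAt {F : Finset E} {v : V} (h : F ⊆ edgesOff ends v) :
    Disjoint F (edgesAt ends v) := by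
  rw [Finset.disjoint_left]
  exact fun e he he' => mem_edgesOff.1 (h he) (mem_edgesAt.1 he')

theorem pdeg_union_edgesAt_self {F : Finset E} {v : V} (h : F ⊆ edgesOff ends v) :
    pdeg ends (F ∪ edgesAt ends v) v = pdeg ends Finset.univ v := by
  rw [pdeg_union (disjoint_edgesAt h), pdeg_edgesAt_self,
    pdeg_eq_zero fun e he => mem_edgesOff.1 (h he), zero_add]

/-- At a vertex of even degree, every bouquet is even, unless `G` is good. -/
theorem pdeg_edgesAt_eq_zero (hl : ∀ e, ¬ (ends e).IsDiag) (hconn : Conn ends)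
    (hn : (Fintype.card V : ZMod 2) = 1) (hgood : ¬ Good ends) {v : V}
    (hv : pdeg ends Finset.univ v = 0) (u : V) : pdeg ends (edgesAt ends v) u = 0 := by
  by_contra hu
  obtain ⟨F₀, hF₀, hF₀f⟩ := exists_isJoin hl hconn hn hgood v
  obtain ⟨F, hFF, hcard, χ, hχ, hsum⟩ := hF₀f.exists_odd_weight
    (k := pdeg ends (edgesAt ends v)) fun h => hu (congrFun h u)
  have hFv : F ⊆ edgesOff ends v := hFF.trans hF₀.1
  obtain ⟨c, hc⟩ := (hF₀f.mono hFF).exists_validAt hl (X := F ∪ edgesAt ends v) {u | u ≠ v}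
    half_of_edgesAt
  have hX := (pdeg_union_edgesAt_self hFv).trans hv
  refine hgood ?_
  rcases zmod_two_cases (pdeg ends ((F ∪ edgesAt ends v).filter fun e => c e = true) v) with h | h
  · classical
    set χ' : V → ZMod 2 := fun u => if u = v then 0 else χ u with hχ'
    set s : E → Bool := fun e => decide (∃ w ∈ ends e, χ' w = 1) with hs
    have hs1 : ∀ e ∈ F ∪ edgesAt ends v, ∀ u ∈ ends e, u ≠ v → (s e = true ↔ χ' u = 1) := by
      intro e he u hue huv
      simp only [hs, decide_eq_true_eq]
      refine ⟨?_, fun h => ⟨u, hue, h⟩⟩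
      rintro ⟨w, hw, hw1⟩
      have hwv : w ≠ v := by rintro rfl; simp [hχ'] at hw1
      by_cases heF : e ∈ F
      · have := eq_of_cob_eq_zero hl (hχ e heF) hue hw
        rw [← hw1]; simp [hχ', huv, hwv, this]
      · rw [half_of_edgesAt e he heF u huv w hwv hue hw, hw1]
    have hs2 : pdeg ends ((F ∪ edgesAt ends v).filter fun e => s e = true) v = 1 := by
      have h1 : pdeg ends ((F ∪ edgesAt ends v).filter fun e => s e = true) v
          = ∑ e ∈ edgesAt ends v, cob ends χ' e := by
        have : pdeg ends ((F ∪ edgesAt ends v).filter fun e => s e = true) v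
          = pdeg ends ((edgesAt ends v).filter fun e => s e = true) v :=
          pdeg_congr fun e he => by simp [he]
        rw [this, pdeg, Finset.sum_filter]
        refine Finset.sum_congr rfl fun e he => ?_
        obtain ⟨x, hx⟩ := mem_edgesAt.1 he
        have hxv := ne_of_ends hl hx
        have := hs1 e (Finset.mem_union_right _ he) x (by simp [hx]) hxv.symm
        rw [cob_eq hl _ hx, show χ' v = 0 by simp [hχ'], zero_add, inc_of_mem (mem_edgesAt.1 he)]
        rcases zmod_two_cases (χ' x) with h | h <;> simp [this, h]
      have hv0 : pdeg ends (edgesAt ends v) v = 0 := (pdeg_edgesAt_self v).trans hv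
      rw [h1, ← handshake, ← hsum]
      refine Finset.sum_congr rfl fun w _ => ?_
      by_cases hw : w = v
      · rw [hw, hv0, mul_zero, mul_zero]
      · simp [hχ', hw]
    refine hF₀.good hFF hcard (c := fun e => c e ^^ s e) fun w => ?_
    by_cases hw : w = v
    · rw [hw]
      exact validAt_of_pdeg hX (by rw [pdeg_filter_xor, h, hs2, zero_add])
    · rcases zmod_two_cases (χ' w) with hχw | hχw
      · refine (hc w hw).congr (fun _ _ => Iff.rfl) fun e he heX => ?_
        have : s e = false := by
          rw [← Bool.not_eq_true, hs1 e heX w he hw, hχw]; exact zero_ne_one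
        simp [this]
      · refine (hc w hw).flip.congr (fun _ _ => Iff.rfl) fun e he heX => ?_
        rw [(hs1 e heX w he hw).2 hχw]; simp
  · refine hF₀.good hFF hcard (c := c) fun w => ?_
    by_cases hw : w = v
    · rw [hw]; exact validAt_of_pdeg hX h
    · exact hc w hw

/-- The neighbors of `v`. -/
noncomputable def nbrs (ends : E → Sym2 V) (v : V) : Finset V :=
  open Classical in Finset.univ.filter fun u => ∃ e, ends e = s(v, u)

theorem mem_nbrs {v u : V} : u ∈ nbrs ends v ↔ ∃ e, ends e = s(v, u) := by
  simp [nbrs]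

theorem ne_of_mem_nbrs (hl : ∀ e, ¬ (ends e).IsDiag) {v u : V} (h : u ∈ nbrs ends v) : u ≠ v := by
  obtain ⟨e, he⟩ := mem_nbrs.1 h
  exact (ne_of_ends hl he).symm

theorem IsJoin.good_of_parities (hl : ∀ e, ¬ (ends e).IsDiag) {v : V}
    (hv : ∀ u, pdeg ends (edgesAt ends v) u = 0) {F₀ F : Finset E} (hF₀ : IsJoin ends v F₀)
    (hF : Forest ends F) (hFF : F ⊆ F₀) (hcard : (F₀ \ F).card ≤ 1) {τ : V → ZMod 2}
    (hτ : ∀ u ∈ nbrs ends v, ∃ c, ValidAt ends (F ∪ edgesAt ends v) c u ∧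
      pdeg ends ((edgesAt ends v).filter fun e => c e = true) u = τ u)
    (hsum : ∑ u ∈ nbrs ends v, τ u = 1) : Good ends := by
  have hFv : F ⊆ edgesOff ends v := hFF.trans hF₀.1
  obtain ⟨c, hc⟩ := hF.exists_coloring_on hl (X := F ∪ edgesAt ends v) {u | u ≠ v}
    half_of_edgesAt (fun u c => ValidAt ends (F ∪ edgesAt ends v) c u ∧ (u ∈ nbrs ends v →
      pdeg ends ((edgesAt ends v).filter fun e => c e = true) u = τ u))
    (by
      rintro u - c c' h ⟨h1, h2⟩
      refine ⟨h1.congr (fun _ _ => Iff.rfl) fun e he heX => h e heX he, fun hu => ?_⟩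
      rw [← h2 hu]
      refine pdeg_congr fun e he => ?_
      simp only [Finset.mem_filter]
      refine and_congr_right fun heK => ?_
      rw [h e (Finset.mem_union_right _ heK) he])
    (by
      rintro u - c ⟨h1, h2⟩
      refine ⟨h1.flip, fun hu => ?_⟩
      have h3 := pdeg_filter_add (ends := ends) (edgesAt ends v) c u
      rw [hv u, h2 hu] at h3
      simp only [Bool.not_eq_true']
      revert h3
      generalize τ u = x
      generalize pdeg ends ((edgesAt ends v).filter fun e => c e = false) u = y
      revert x y; decide)
    (by
      rintro u -
      by_cases hu : u ∈ nbrs ends v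
      · obtain ⟨c, h1, h2⟩ := hτ u hu
        exact ⟨c, h1, fun _ => h2⟩
      · obtain ⟨c, hc⟩ := exists_validAt (ends := ends) (F ∪ edgesAt ends v) u
        exact ⟨c, hc, fun h => absurd h hu⟩)
  refine hF₀.good hFF hcard (c := c) fun w => ?_
  by_cases hw : w = v
  · rw [hw]
    refine validAt_of_pdeg ?_ ?_
    · rw [pdeg_union_edgesAt_self hFv, ← pdeg_edgesAt_self, hv]
    · have h1 : pdeg ends ((F ∪ edgesAt ends v).filter fun e => c e = true) v
          = ∑ e ∈ (edgesAt ends v).filter fun e => c e = true,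
            cob ends (fun u => if u = v then 0 else 1) e := by
        have : pdeg ends ((F ∪ edgesAt ends v).filter fun e => c e = true) v
          = pdeg ends ((edgesAt ends v).filter fun e => c e = true) v :=
          pdeg_congr fun e he => by simp [he]
        rw [this, pdeg]
        refine Finset.sum_congr rfl fun e he => ?_
        have he := mem_edgesAt.1 (Finset.mem_filter.1 he).1
        rw [inc_of_mem he]
        obtain ⟨x, hx⟩ := he
        rw [cob_eq hl _ hx]
        simp [(ne_of_ends hl hx).symm]
      rw [h1, ← handshake]
      refine Eq.trans ?_ hsum
      rw [← Finset.sum_subset (Finset.subset_univ (nbrs ends v))]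
      · refine Finset.sum_congr rfl fun u hu => ?_
        have huv := ne_of_mem_nbrs hl hu
        rw [if_neg huv, one_mul, (hc u huv).2 hu]
      · intro u _ hu
        by_cases huv : u = v
        · simp [huv]
        · rw [pdeg_eq_zero, mul_zero]
          intro e he hue
          have hve := mem_edgesAt.1 (Finset.mem_filter.1 he).1
          exact hu (mem_nbrs.2 ⟨e, (Sym2.mem_and_mem_iff (Ne.symm huv)).1 ⟨hve, hue⟩⟩)
  · exact (hc w hw).1

theorem IsJoin.nbrs_parity (hl : ∀ e, ¬ (ends e).IsDiag) (hgood : ¬ Good ends) {v : V}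
    (hv : ∀ u, pdeg ends (edgesAt ends v) u = 0) {F₀ F : Finset E} (hF₀ : IsJoin ends v F₀)
    (hF : Forest ends F) (hFF : F ⊆ F₀) (hcard : (F₀ \ F).card ≤ 1) :
    ∑ u ∈ nbrs ends v, (1 + pdeg ends F u) = 0 ∧
      ∀ u ∈ nbrs ends v, (∀ e ∈ F, u ∉ ends e) ∨ pdeg ends F u = 1 := by
  have hFv : F ⊆ edgesOff ends v := hFF.trans hF₀.1
  have hX : ∀ u, pdeg ends (F ∪ edgesAt ends v) u = pdeg ends F u := fun u => by
    rw [pdeg_union (disjoint_edgesAt hFv), hv, add_zero]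
  have hsingle : ∀ X : Finset E, ∀ g ∈ X, X.filter (fun e => decide (e = g) = true) = {g} := by
    intro X g hg
    ext e
    simp only [decide_eq_true_eq, Finset.mem_filter, Finset.mem_singleton]
    constructor
    · exact fun h => h.2
    · rintro rfl; exact ⟨hg, rfl⟩
  have hpd : ∀ (g : E) (u : V), u ∈ ends g → pdeg ends {g} u = 1 := fun g u h => by
    rw [pdeg, Finset.sum_singleton, inc_of_mem h]
  have hτ : ∀ u ∈ nbrs ends v, ∃ c, ValidAt ends (F ∪ edgesAt ends v) c u ∧
      pdeg ends ((edgesAt ends v).filter fun e => c e = true) u = 1 + pdeg ends F u := by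
    intro u hu
    rcases zmod_two_cases (pdeg ends F u) with h | h
    · obtain ⟨g, hg⟩ := mem_nbrs.1 hu
      have hgu : u ∈ ends g := by simp [hg]
      have hgK : g ∈ edgesAt ends v := by simp [hg]
      refine ⟨fun e => decide (e = g), validAt_of_pdeg ((hX u).trans h) ?_, ?_⟩
      · rw [hsingle _ g (Finset.mem_union_right _ hgK), hpd g u hgu]
      · rw [hsingle _ g hgK, hpd g u hgu, h, add_zero]
    · refine ⟨fun _ => true, ⟨Or.inr ?_, Or.inl (by simp)⟩, ?_⟩
      · simp [hX, h]
      · simp only [Finset.filter_true, hv, h]; decide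
  have hsum : ∑ u ∈ nbrs ends v, (1 + pdeg ends F u) = 0 := by
    by_contra hne
    exact hgood (hF₀.good_of_parities hl hv hF hFF hcard hτ (zmod_two_eq_one hne))
  refine ⟨hsum, fun u hu => ?_⟩
  by_contra! hcon
  obtain ⟨⟨g, hgF, hgu⟩, h1⟩ := hcon
  have h0 := (zmod_two_cases _).resolve_right h1
  refine hgood (hF₀.good_of_parities hl hv hF hFF hcard
    (τ := Function.update (fun u => 1 + pdeg ends F u) u 0) (fun w hw => ?_) ?_)
  · by_cases hwu : w = u
    · subst hwu
      refine ⟨fun e => decide (e = g), validAt_of_pdeg ((hX w).trans h0) ?_, ?_⟩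
      · rw [hsingle _ g (Finset.mem_union_left _ hgF), hpd g w hgu]
      · rw [Function.update_self]
        refine pdeg_eq_zero fun e he => ?_
        simp only [decide_eq_true_eq, Finset.mem_filter] at he
        rw [he.2] at he
        exact absurd he.1 (Finset.disjoint_left.1 (disjoint_edgesAt hFv) hgF)
    · rw [Function.update_of_ne hwu]; exact hτ w hw
  · rw [Finset.sum_update_of_mem hu, zero_add]
    rw [← Finset.add_sum_erase _ _ hu, h0, add_zero, ← Finset.sdiff_singleton_eq_erase] at hsum
    revert hsum
    generalize ∑ x ∈ nbrs ends v \ {u}, (1 + pdeg ends F x) = y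
    revert y; decide

/-- A connected loopless multigraph of odd order that is not good. -/
structure IsBad (ends : E → Sym2 V) : Prop where
  loopless : ∀ e, ¬ (ends e).IsDiag
  conn : Conn ends
  odd_order : (Fintype.card V : ZMod 2) = 1
  not_good : ¬ Good ends

theorem card_sdiff_erase_le (F : Finset E) (e : E) : (F \ F.erase e).card ≤ 1 := by
  refine (Finset.card_le_card (t := {e}) fun e' => ?_).trans (Finset.card_singleton e).le
  simp only [Finset.mem_sdiff, Finset.mem_erase, Finset.mem_singleton]
  tauto

theorem card_insert_sdiff_le (F : Finset E) (e : E) : (insert e F \ F).card ≤ 1 := by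
  refine (Finset.card_le_card (t := {e}) fun e' => ?_).trans (Finset.card_singleton e).le
  simp only [Finset.mem_sdiff, Finset.mem_insert, Finset.mem_singleton]
  tauto

theorem inc_eq (hl : ∀ e, ¬ (ends e).IsDiag) {e : E} {a b : V} (h : ends e = s(a, b)) (u : V) :
    inc ends e u = (if u = a then 1 else 0) + if u = b then 1 else 0 := by
  have := ne_of_ends hl h
  simp only [inc, h, Sym2.mem_iff]
  by_cases h1 : u = a
  · subst h1; simp [this]
  · simp [h1]

theorem sum_inc_eq (hl : ∀ e, ¬ (ends e).IsDiag) {e : E} {a b : V} (h : ends e = s(a, b))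
    (M : Finset V) : ∑ u ∈ M, inc ends e u = (if a ∈ M then 1 else 0) + if b ∈ M then 1 else 0 := by
  simp only [inc_eq hl h, Finset.sum_add_distrib, Finset.sum_ite_eq']

theorem inc_triangle (hl : ∀ e, ¬ (ends e).IsDiag) {e₁ e₂ e₃ : E} {a b c : V}
    (h₁ : ends e₁ = s(a, b)) (h₂ : ends e₂ = s(b, c)) (h₃ : ends e₃ = s(c, a)) (u : V) :
    inc ends e₁ u + (inc ends e₂ u + inc ends e₃ u) = 0 := by
  rw [inc_eq hl h₁, inc_eq hl h₂, inc_eq hl h₃]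
  split_ifs <;> decide

theorem exists_parallel {v u : V} (hv : pdeg ends (edgesAt ends v) u = 0) (huv : v ≠ u) {g : E}
    (hg : ends g = s(v, u)) : ∃ g', g' ≠ g ∧ ends g' = s(v, u) := by
  by_contra! hcon
  have : pdeg ends (edgesAt ends v) u = pdeg ends {g} u := by
    refine pdeg_congr fun e he => ?_
    rw [mem_edgesAt, Finset.mem_singleton]
    constructor
    · intro h
      by_contra hne
      exact hcon e hne ((Sym2.mem_and_mem_iff huv).1 ⟨h, he⟩)
    · rintro rfl; simp [hg]
  rw [this, pdeg, Finset.sum_singleton, inc_of_mem (by simp [hg])] at hv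
  exact one_ne_zero hv

theorem exists_mem_of_pdeg_eq_one {F : Finset E} {u : V} (h : pdeg ends F u = 1) :
    ∃ e ∈ F, u ∈ ends e := by
  by_contra! hcon
  rw [pdeg_eq_zero hcon] at h
  exact zero_ne_one h

theorem IsJoin.unique_edge (h : IsBad ends) {v : V} (hv : ∀ u, pdeg ends (edgesAt ends v) u = 0)
    {F : Finset E} (hF : IsJoin ends v F) (hFf : Forest ends F) {e : E} (he : e ∈ F) {u z : V}
    (heu : ends e = s(u, z)) (hu : u ∈ nbrs ends v) :
    (∀ e' ∈ F, u ∈ ends e' → e' = e) ∧ z ∈ nbrs ends v := by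
  have h1 := hF.nbrs_parity h.loopless h.not_good hv hFf subset_rfl (by simp)
  have h2 := hF.nbrs_parity h.loopless h.not_good hv (hFf.mono (Finset.erase_subset e F))
    (Finset.erase_subset e F) (card_sdiff_erase_le F e)
  have hue : u ∈ ends e := by simp [heu]
  have hFu : pdeg ends F u = 1 := (h1.2 u hu).resolve_left fun h => h e he hue
  constructor
  · rcases h2.2 u hu with h3 | h3
    · intro e' he' hu'
      by_contra hne
      exact h3 e' (Finset.mem_erase.2 ⟨hne, he'⟩) hu'
    · rw [pdeg_erase he, hFu, inc_of_mem hue] at h3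
      exact absurd h3 (by decide)
  · by_contra hz
    have h3 := h2.1
    simp only [pdeg_erase he] at h3
    have h4 := h1.1
    rw [Finset.sum_add_distrib] at h3 h4
    rw [Finset.sum_add_distrib, sum_inc_eq h.loopless heu, if_pos hu, if_neg hz] at h3
    revert h3 h4
    generalize ∑ x ∈ nbrs ends v, (1 : ZMod 2) = x
    generalize ∑ x ∈ nbrs ends v, pdeg ends F x = y
    revert x y; decide

theorem cob_update (hl : ∀ e, ¬ (ends e).IsDiag) (χ : V → ZMod 2) {v : V} (x : ZMod 2) {e : E}
    (he : v ∉ ends e) : cob ends (Function.update χ v x) e = cob ends χ e := by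
  obtain ⟨a, b, hab⟩ := exists_ends (ends := ends) e
  rw [hab, Sym2.mem_iff, not_or] at he
  rw [cob_eq hl _ hab, cob_eq hl _ hab, Function.update_of_ne (Ne.symm he.1),
    Function.update_of_ne (Ne.symm he.2)]

/-- An edge of `G - v` that joins a neighbor of `v` to a non-neighbor is a bridge of `G - v`. -/
theorem IsBad.exists_cut (h : IsBad ends) {v : V} (hv : ∀ u, pdeg ends (edgesAt ends v) u = 0)
    {f : E} {u y : V} (hf : ends f = s(u, y)) (hu : u ∈ nbrs ends v) (hy : y ∉ nbrs ends v)
    (hyv : y ≠ v) : ∃ χ : V → ZMod 2, χ u = 1 ∧ χ y = 0 ∧ χ v = 0 ∧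
      ∀ e, v ∉ ends e → e ≠ f → cob ends χ e = 0 := by
  have huv := ne_of_mem_nbrs h.loopless hu
  have hvf : v ∉ ends f := by simp [hf, huv.symm, hyv.symm]
  set S := (edgesOff ends v).erase f with hS
  have hmem : ∀ e, e ∈ S ↔ e ≠ f ∧ v ∉ ends e := fun e => by simp [hS]
  by_cases hj : ∀ χ : V → ZMod 2, (∀ e ∈ S, cob ends χ e = 0) →
      ∑ w, χ w * (pdeg ends S w + (1 + if w = v then 1 else 0)) = 0
  · exfalso
    obtain ⟨F, hFS, hFf, hFt⟩ := exists_join S _ hj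
    obtain ⟨F₀, hF₀, hF₀f⟩ := exists_isJoin h.loopless h.conn h.odd_order h.not_good v
    have hfF : f ∉ F := fun hfF => ((hmem f).1 (hFS hfF)).1 rfl
    have hFw : ∀ w, w ≠ v → pdeg ends F w = pdeg ends (edgesOff ends v) w + 1 + inc ends f w := by
      intro w hw
      rw [hFt, if_neg hw, hS, pdeg_erase (by simpa using hvf)]
      ring
    have hF₁ : IsJoin ends v (insert f F) := by
      refine ⟨Finset.insert_subset (by simpa using hvf) fun e he => ?_, fun w hw => ?_⟩
      · rw [mem_edgesOff]; exact ((hmem e).1 (hFS he)).2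
      · rw [pdeg_insert hfF, hFw w hw, add_comm, add_assoc, zmod_two_add_self, add_zero]
    have h1 := (hF₁.nbrs_parity h.loopless h.not_good hv hFf (Finset.subset_insert _ _)
      (card_insert_sdiff_le F f)).1
    have h2 := (hF₀.nbrs_parity h.loopless h.not_good hv hF₀f subset_rfl (by simp)).1
    have h3 : ∀ w ∈ nbrs ends v, 1 + pdeg ends F w = (1 + pdeg ends F₀ w) + inc ends f w := by
      intro w hw
      have hwv := ne_of_mem_nbrs h.loopless hw
      rw [hFw w hwv, hF₀.2 w hwv]; ring
    rw [Finset.sum_congr rfl h3, Finset.sum_add_distrib, h2, sum_inc_eq h.loopless hf, if_pos hu,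
      if_neg hy] at h1
    exact absurd h1 (by decide)
  · push Not at hj
    obtain ⟨χ, hχ, hsum⟩ := hj
    have hχ' : ∀ e, v ∉ ends e → e ≠ f → cob ends χ e = 0 := fun e he hef =>
      hχ e ((hmem e).2 ⟨hef, he⟩)
    have hfχ : cob ends χ f = 1 := by
      refine zmod_two_eq_one fun hf0 => hsum ?_
      simp only [mul_add, Finset.sum_add_distrib, handshake, mul_one]
      rw [Finset.sum_eq_zero hχ, zero_add,
        sum_eq_of_closed_off h.loopless h.conn h.odd_order h.not_good v χ fun e he => ?_]
      · simp [zmod_two_add_self]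
      · by_cases hef : e = f
        · rw [hef, hf0]
        · exact hχ' e he hef
    rw [cob_eq h.loopless _ hf] at hfχ
    have key : ∀ ψ : V → ZMod 2, ψ u = 1 → ψ y = 0 →
        (∀ e, v ∉ ends e → e ≠ f → cob ends ψ e = 0) → ∃ χ : V → ZMod 2, χ u = 1 ∧ χ y = 0 ∧
          χ v = 0 ∧ ∀ e, v ∉ ends e → e ≠ f → cob ends χ e = 0 := fun ψ h1 h2 h3 =>
      ⟨Function.update ψ v 0, by simp [huv, h1], by simp [hyv, h2], by simp,
        fun e he hef => by rw [cob_update h.loopless ψ 0 he, h3 e he hef]⟩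
    rcases zmod_two_cases (χ u) with hχu | hχu
    · refine key (χ + 1) (by simp [hχu]) ?_ fun e he hef => ?_
      · rw [hχu, zero_add] at hfχ
        simp [hfχ]; decide
      · rw [cob_add, hχ' e he hef, zero_add]; exact cob_const_one h.loopless e
    · refine key χ hχu ?_ hχ'
      rw [hχu] at hfχ; simpa using hfχ

theorem mem_nbrs_comm {u v : V} : u ∈ nbrs ends v ↔ v ∈ nbrs ends u := by
  simp only [mem_nbrs, Sym2.eq_swap]

theorem IsBad.mem_nbrs_trans (h : IsBad ends) {v w y : V}
    (hv : ∀ u, pdeg ends (edgesAt ends v) u = 0) (hw : ∀ u, pdeg ends (edgesAt ends w) u = 0)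
    (hwv : w ∈ nbrs ends v) (hy : y ∈ nbrs ends w) (hyv : y ≠ v) : y ∈ nbrs ends v := by
  by_contra hyn
  obtain ⟨g, hg⟩ := mem_nbrs.1 hy
  obtain ⟨g', hne, hg'⟩ := exists_parallel (hw y) (ne_of_mem_nbrs h.loopless hy).symm hg
  obtain ⟨χ, h1, h2, -, h3⟩ := h.exists_cut hv hg hwv hyn hyv
  have := h3 g' (by simp [hg', (ne_of_mem_nbrs h.loopless hwv).symm, hyv.symm]) hne
  rw [cob_eq h.loopless _ hg', h1, h2] at this
  simp at this

theorem IsBad.mem_of_closed (h : IsBad ends) {a : V} (T : Finset V) (ha : a ∈ T)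
    (hT : ∀ u ∈ T, ∀ w, w ∈ nbrs ends u → w ∈ T) (w : V) : w ∈ T := by
  have := h.conn (fun u => if u ∈ T then 1 else 0) (fun e => ?_) w a
  · by_contra hw
    simp [ha, hw] at this
  · obtain ⟨p, q, hpq⟩ := exists_ends (ends := ends) e
    rw [cob_eq_zero_iff h.loopless hpq]
    have : p ∈ T ↔ q ∈ T := ⟨fun hp => hT p hp q (mem_nbrs.2 ⟨e, hpq⟩),
      fun hq => hT q hq p (mem_nbrs.2 ⟨e, hpq.trans Sym2.eq_swap⟩)⟩
    simp only [this]

/-- Replacing one edge of a triangle in a join by the other two gives a join. -/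
theorem IsJoin.swap_triangle (hl : ∀ e, ¬ (ends e).IsDiag) {v : V} {F : Finset E}
    (hF : IsJoin ends v F) {e e₁ e₂ : E} {a b c : V} (he : ends e = s(a, b))
    (h₁ : ends e₁ = s(b, c)) (h₂ : ends e₂ = s(c, a)) (heF : e ∈ F) (h₁F : e₁ ∉ F) (h₂F : e₂ ∉ F)
    (ha : a ≠ v) (hb : b ≠ v) (hc : c ≠ v) : IsJoin ends v (insert e₂ (insert e₁ (F.erase e))) := by
  have h12 : e₂ ≠ e₁ := by
    rintro rfl
    rw [h₁] at h₂
    have := ne_of_ends hl he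
    have := ne_of_ends hl h₁
    simp only [Sym2.eq_iff] at h₂
    grind
  refine ⟨?_, fun u hu => ?_⟩
  · refine Finset.insert_subset ?_ (Finset.insert_subset ?_ ((Finset.erase_subset _ _).trans hF.1))
    · simp [h₂, ha.symm, hc.symm]
    · simp [h₁, hb.symm, hc.symm]
  · have h3 := inc_triangle hl he h₁ h₂ u
    rw [pdeg_insert, pdeg_insert, pdeg_erase heF, ← hF.2 u hu]
    · linear_combination h3
    · simp [h₁F]
    · simp [h12, h₂F]

theorem IsBad.even_neighbor (h : IsBad ends) {v w : V}
    (hv : pdeg ends Finset.univ v = 0) (hw : pdeg ends Finset.univ w = 0)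
    (hwv : w ∈ nbrs ends v) :
    Fintype.card V = 3 ∧
      ∀ u u' : V, u ≠ u' → u' ∈ nbrs ends u ∧ pdeg ends (edgesAt ends u) u' = 0 := by
  have hl := h.loopless
  have heven : ∀ {v}, pdeg ends Finset.univ v = 0 → ∀ u, pdeg ends (edgesAt ends v) u = 0 :=
    fun hv u => pdeg_edgesAt_eq_zero hl h.conn h.odd_order h.not_good hv u
  have htrans : ∀ {v w y}, pdeg ends Finset.univ v = 0 → pdeg ends Finset.univ w = 0 →
      w ∈ nbrs ends v → y ∈ nbrs ends w → y ≠ v → y ∈ nbrs ends v :=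
    fun hv hw hwv hy hyv => h.mem_nbrs_trans (heven hv) (heven hw) hwv hy hyv
  have hv' := heven hv
  have hwv0 := ne_of_mem_nbrs hl hwv
  obtain ⟨F, hF, hFf⟩ := exists_isJoin hl h.conn h.odd_order h.not_good v
  have hFdeg : ∀ u, u ≠ v → pdeg ends F u = pdeg ends Finset.univ u + 1 := fun u hu => by
    rw [hF.2 u hu, ← pdeg_edgesOff_add v u, hv', add_zero]
  obtain ⟨e, heF, hwe⟩ := exists_mem_of_pdeg_eq_one
    (show pdeg ends F w = 1 by rw [hFdeg w hwv0, hw, zero_add])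
  obtain ⟨z, hz⟩ := hwe
  obtain ⟨hw1, hzv⟩ := hF.unique_edge h hv' hFf heF hz hwv
  obtain ⟨hz1, -⟩ := hF.unique_edge h hv' hFf heF (hz.trans Sym2.eq_swap) hzv
  have hzv0 := ne_of_mem_nbrs hl hzv
  have hwz := ne_of_ends hl hz
  have hzd : pdeg ends Finset.univ z = 0 := by
    have h1 := hFdeg z hzv0
    have h2 : pdeg ends F z = 1 := by
      have : pdeg ends F z = pdeg ends {e} z := pdeg_congr fun e' he' => by
        rw [Finset.mem_singleton]
        exact ⟨fun h => hz1 e' h he', fun h => h ▸ heF⟩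
      rw [this, pdeg, Finset.sum_singleton, inc_of_mem (by simp [hz])]
    rw [h2] at h1
    revert h1; generalize pdeg ends Finset.univ z = x
    revert x; decide
  have hM : ∀ j ∈ nbrs ends v, j = w ∨ j = z := by
    intro j hj
    by_contra! hcon
    obtain ⟨hjw, hjz⟩ := hcon
    have hjv0 := ne_of_mem_nbrs hl hj
    obtain ⟨e₁, h₁⟩ := mem_nbrs.1 (htrans hw hv (mem_nbrs_comm.1 hwv) hj hjw)
    obtain ⟨e₂, h₂⟩ := mem_nbrs.1 (htrans hzd hv (mem_nbrs_comm.1 hzv) hj hjz)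
    have h₁F : e₁ ∉ F := fun h' => by
      have := hw1 e₁ h' (by simp [h₁])
      rw [this, hz, Sym2.eq_iff] at h₁
      grind
    have h₂F : e₂ ∉ F := fun h' => by
      have := hz1 e₂ h' (by simp [h₂])
      rw [this, hz, Sym2.eq_iff] at h₂
      grind
    by_cases hjF : ∀ e' ∈ F, j ∉ ends e'
    · have hJ := hF.swap_triangle hl (hz.trans Sym2.eq_swap) h₁ (h₂.trans Sym2.eq_swap) heF h₁F h₂F
        hzv0 hwv0 hjv0
      have hf : Forest ends (insert e₂ (insert e₁ (F.erase e))) := by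
        refine Forest.insert_leaf hl (Forest.insert_leaf hl (hFf.mono (Finset.erase_subset _ _)) h₁
          fun e' he' h' => ?_) h₂ fun e' he' h' => ?_
        · exact Finset.ne_of_mem_erase he' (hw1 e' (Finset.mem_of_mem_erase he') h')
        · rcases Finset.mem_insert.1 he' with rfl | he'
          · simp [h₁, hwz.symm, hjz.symm] at h'
          · exact Finset.ne_of_mem_erase he' (hz1 e' (Finset.mem_of_mem_erase he') h')
      rcases (hJ.nbrs_parity hl h.not_good hv' hf subset_rfl (by simp)).2 j hj with h' | h'
      · exact h' e₁ (by simp) (by simp [h₁])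
      · rw [hJ.2 j hjv0, ← hF.2 j hjv0, pdeg_eq_zero hjF] at h'
        exact zero_ne_one h'
    · push Not at hjF
      obtain ⟨e₃, h₃F, hj3⟩ := hjF
      obtain ⟨k, hk⟩ := hj3
      obtain ⟨hj1, hkv⟩ := hF.unique_edge h hv' hFf h₃F hk hj
      obtain ⟨hk1, -⟩ := hF.unique_edge h hv' hFf h₃F (hk.trans Sym2.eq_swap) hkv
      have hkw : k ≠ w := by
        rintro rfl
        have := hw1 e₃ h₃F (by simp [hk])
        rw [this, hz, Sym2.eq_iff] at hk
        grind
      have hkv0 := ne_of_mem_nbrs hl hkv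
      obtain ⟨e₄, h₄⟩ := mem_nbrs.1 (htrans hw hv (mem_nbrs_comm.1 hwv) hkv hkw)
      have hjk := ne_of_ends hl hk
      have h₄F : e₄ ∉ F := fun h' => by
        have := hk1 e₄ h' (by simp [h₄])
        rw [this, hk, Sym2.eq_iff] at h₄
        grind
      have hJ := hF.swap_triangle hl (hk.trans Sym2.eq_swap) (h₁.trans Sym2.eq_swap) h₄ h₃F h₁F h₄F
        hkv0 hjv0 hwv0
      have hf : Forest ends (insert e₄ (insert e₁ (F.erase e₃))) := by
        refine Forest.insert_leaf hl (Forest.insert_leaf hl (hFf.mono (Finset.erase_subset _ _))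
          (h₁.trans Sym2.eq_swap) fun e' he' h' => ?_) (h₄.trans Sym2.eq_swap) fun e' he' h' => ?_
        · exact Finset.ne_of_mem_erase he' (hj1 e' (Finset.mem_of_mem_erase he') h')
        · rcases Finset.mem_insert.1 he' with rfl | he'
          · simp [h₁, hkw, hjk.symm] at h'
          · exact Finset.ne_of_mem_erase he' (hk1 e' (Finset.mem_of_mem_erase he') h')
      have h5 := (hJ.unique_edge h hv' hf (e := e₁) (by simp) h₁ hwv).1 e₄ (by simp) (by simp [h₄])
      rw [h5, h₁, Sym2.eq_iff] at h₄
      grind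
  have hT : ∀ u, u ∈ ({v, w, z} : Finset V) := by
    refine h.mem_of_closed (a := v) _ (by simp) fun u hu y hy => ?_
    simp only [Finset.mem_insert, Finset.mem_singleton] at hu ⊢
    by_cases hyv : y = v
    · exact Or.inl hyv
    refine Or.inr ?_
    rcases hu with rfl | rfl | rfl
    · exact hM y hy
    · exact hM y (htrans hv hw hwv hy hyv)
    · exact hM y (htrans hv hzd hzv hy hyv)
  have hdeg : ∀ u, pdeg ends Finset.univ u = 0 := by
    intro u
    have := hT u
    simp only [Finset.mem_insert, Finset.mem_singleton] at this
    rcases this with rfl | rfl | rfl <;> assumption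
  have hwz' : z ∈ nbrs ends w := mem_nbrs.2 ⟨e, hz⟩
  refine ⟨?_, fun u u' hne => ⟨?_, heven (hdeg u) u'⟩⟩
  · rw [← Finset.card_univ, ← Finset.eq_univ_iff_forall.2 hT]
    rw [Finset.card_insert_of_notMem (by simp [hwv0.symm, hzv0.symm]),
      Finset.card_insert_of_notMem (by simp [hwz]), Finset.card_singleton]
  · have h1 := hT u
    have h2 := hT u'
    simp only [Finset.mem_insert, Finset.mem_singleton] at h1 h2
    rcases h1 with rfl | rfl | rfl <;> rcases h2 with rfl | rfl | rfl <;>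
      first
      | exact absurd rfl hne
      | assumption
      | exact mem_nbrs_comm.1 (by assumption)

theorem pdeg_singleton (e : E) (u : V) : pdeg ends {e} u = inc ends e u :=
  Finset.sum_singleton _ _

theorem IsBad.not_exists_isJoin_avoiding (h : IsBad ends) {v u j : V}
    (hv : ∀ w, pdeg ends (edgesAt ends v) w = 0) (hu : u ∈ nbrs ends v) (hj : j ∈ nbrs ends v)
    (huj : u ≠ j) (hadj : j ∉ nbrs ends u) (hdu : pdeg ends Finset.univ u = 1) {F : Finset E}
    (hF : IsJoin ends u F) (hFf : Forest ends F) (hFj : ∀ e ∈ F, j ∉ ends e) : False := by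
  have hl := h.loopless
  have huv := ne_of_mem_nbrs hl hu
  have hjv := ne_of_mem_nbrs hl hj
  obtain ⟨e, he⟩ := mem_nbrs.1 hu
  have heK : e ∈ edgesAt ends u := by simp [he]
  have hFK := disjoint_edgesAt hF.1
  have hFe : ∀ e ∈ F, u ∉ ends e := fun e he => mem_edgesOff.1 (hF.1 he)
  set X := F ∪ (edgesAt ends u).erase e with hXdef
  have hXK : X ⊆ F ∪ edgesAt ends u := Finset.union_subset_union_right (Finset.erase_subset _ _)
  have hXd : ∀ w, pdeg ends X w = pdeg ends F w + (inc ends e w + pdeg ends (edgesAt ends u) w) :=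
    fun w => by
      rw [hXdef, pdeg_union (Finset.disjoint_of_subset_right (Finset.erase_subset _ _) hFK),
        pdeg_erase heK]
  obtain ⟨c, hc⟩ := hFf.exists_validAt hl (X := X) {w | w ≠ u}
    fun e' he' => half_of_edgesAt e' (hXK he')
  have hXu : pdeg ends X u = 0 := by
    rw [hXd, pdeg_eq_zero hFe, pdeg_edgesAt_self, hdu, inc_of_mem (by simp [he])]; decide
  rcases zmod_two_cases (pdeg ends (X.filter fun e => c e = true) u) with hcu | hcu
  · obtain ⟨g, hgne, hg⟩ := exists_parallel (hv u) huv.symm he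
    obtain ⟨g₁, hg₁⟩ := mem_nbrs.1 hj
    obtain ⟨g₂, hg₂₁, hg₂⟩ := exists_parallel (hv j) hjv.symm hg₁
    have hgX : g ∈ X := Finset.mem_union_right _ (Finset.mem_erase.2 ⟨hgne, by simp [hg]⟩)
    have hjX : ∀ e' ∈ X, j ∉ ends e' := by
      intro e' he' hje
      rcases Finset.mem_union.1 he' with h' | h'
      · exact hFj e' h' hje
      · have h' := mem_edgesAt.1 (Finset.mem_of_mem_erase h')
        exact hadj (mem_nbrs.2 ⟨e', (Sym2.mem_and_mem_iff huj).1 ⟨h', hje⟩⟩)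
    have hj₁ : j ∈ ends g₁ := by simp [hg₁]
    have hj₂ : j ∈ ends g₂ := by simp [hg₂]
    have hX₁ : g₁ ∉ X := fun h' => hjX g₁ h' hj₁
    have hX₂ : g₂ ∉ X := fun h' => hjX g₂ h' hj₂
    have hu₁ : u ∉ ends g₁ := by simp [hg₁, huv, huj]
    have hu₂ : u ∉ ends g₂ := by simp [hg₂, huv, huj]
    have hinc : ∀ w, inc ends g₂ w = inc ends g₁ w := fun w => by simp only [inc, hg₁, hg₂]
    have hH : edgesOff ends u \ (insert g₁ (insert g₂ F)) =
        ((edgesOff ends u \ F).erase g₁).erase g₂ := by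
      ext x; simp only [Finset.mem_sdiff, Finset.mem_insert, Finset.mem_erase]; tauto
    set c' : E → Bool := fun x => if x = g₁ then true else if x = g₂ then false else
      (c x ^^ decide (x = g)) with hc'
    set Y := insert g₁ (insert g₂ X) with hY
    have hYd : ∀ w, pdeg ends Y w = pdeg ends X w := fun w => by
      rw [hY, pdeg_insert (by simp [hX₁, hg₂₁.symm]), pdeg_insert hX₂, hinc, ← add_assoc,
        zmod_two_add_self, zero_add]
    have hYc : ∀ w, pdeg ends (Y.filter fun x => c' x = true) w =
        inc ends g₁ w + (pdeg ends (X.filter fun x => c x = true) w + inc ends g w) := by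
      intro w
      have h1 : X.filter (fun x => decide (x = g) = true) = {g} := by
        ext x
        simp only [decide_eq_true_eq, Finset.mem_filter, Finset.mem_singleton]
        exact ⟨fun h => h.2, fun h => ⟨h ▸ hgX, h⟩⟩
      rw [← pdeg_singleton g, ← h1, ← pdeg_filter_xor, ← pdeg_insert (by simp [hX₁])]
      congr 1
      ext x
      by_cases h1 : x = g₁
      · simp [h1, hY, hc']
      by_cases h2 : x = g₂
      · simp [h2, hY, hc', hX₂, hg₂₁]
      · simp [h1, h2, hY, hc']
    refine h.not_good (Good.of_validAt (X := Y) (H := edgesOff ends u \ (insert g₁ (insert g₂ F)))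
      (c := c') ?_ (fun w => ?_) (fun w => ?_) ?_)
    · rw [Finset.disjoint_left]
      intro x hx hx'
      simp only [hY, hXdef, Finset.mem_insert, Finset.mem_union, Finset.mem_erase, mem_edgesAt,
        Finset.mem_sdiff, mem_edgesOff] at hx hx'
      tauto
    · by_cases hwu : w = u
      · subst hwu
        refine validAt_of_pdeg ((hYd w).trans hXu) ?_
        rw [hYc, hcu, inc_of_notMem hu₁, inc_of_mem (by simp [hg])]; decide
      by_cases hwj : w = j
      · subst hwj
        have h0 : ∀ Z ⊆ X, pdeg ends Z w = 0 := fun Z hZ => pdeg_eq_zero fun x hx => hjX x (hZ hx)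
        refine validAt_of_pdeg ((hYd w).trans (h0 X subset_rfl)) ?_
        rw [hYc, h0 _ (Finset.filter_subset _ _), inc_of_mem hj₁,
          inc_of_notMem (by simp [hg, hwu, hjv])]; decide
      by_cases hwv : w = v
      · subst hwv
        have hXw : pdeg ends X w = 0 := by
          have h1 := pdeg_edgesOff_add (ends := ends) u w
          rw [← pdeg_edgesAt_self w, hv w] at h1
          rw [hXd, hF.2 w huv.symm, inc_of_mem (by simp [he])]
          linear_combination h1 + zmod_two_add_self 1
        have hcw : pdeg ends (X.filter fun x => c x = true) w = 1 := by
          obtain ⟨h1, h2⟩ := hc w hwu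
          rcases h1 with h1 | h1
          · have h3 := pdeg_filter_add (ends := ends) X c w
            rw [hXw, pdeg_eq_zero h1, zero_add] at h3
            rcases h2 with h2 | h2
            · exfalso
              have hwg : w ∈ ends g := by simp [hg]
              cases hcg : c g with
              | true => exact h1 g (Finset.mem_filter.2 ⟨hgX, hcg⟩) hwg
              | false => exact h2 g (Finset.mem_filter.2 ⟨hgX, hcg⟩) hwg
            · rw [h3] at h2; exact absurd h2 zero_ne_one
          · exact h1
        refine validAt_of_pdeg ((hYd w).trans hXw) ?_
        rw [hYc, hcw, inc_of_mem (by simp [hg₁]), inc_of_mem (by simp [hg])]; decide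
      · refine (hc w hwu).congr (fun x hx => ?_) (fun x hx _ => ?_)
        all_goals
          have h1 : x ≠ g₁ := by rintro rfl; simp [hg₁, hwj, hwv] at hx
          have h2 : x ≠ g₂ := by rintro rfl; simp [hg₂, hwj, hwv] at hx
          have h3 : x ≠ g := by rintro rfl; simp [hg, hwu, hwv] at hx
        · simp [hY, h1, h2]
        · simp [hc', h1, h2, h3]
    · rw [hH]
      rcases hF.oddAt_sdiff w with h1 | h1
      · exact Or.inl fun x hx => h1 x (Finset.mem_of_mem_erase (Finset.mem_of_mem_erase hx))
      · right
        have hF₁ : g₁ ∉ F := fun h' => hX₁ (Finset.mem_union_left _ h')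
        have hF₂ : g₂ ∉ F := fun h' => hX₂ (Finset.mem_union_left _ h')
        rw [pdeg_erase (by simp [hg₂₁, hu₂, hF₂]), pdeg_erase (by simp [hu₁, hF₁]), h1, hinc,
          ← add_assoc, zmod_two_add_self, zero_add]
    · refine (Finset.card_le_card (t := {e}) fun x => ?_).trans (Finset.card_singleton e).le
      simp only [hY, hXdef, Finset.mem_insert, Finset.mem_union, Finset.mem_erase, mem_edgesAt,
        Finset.mem_sdiff, mem_edgesOff, Finset.mem_univ, Finset.mem_singleton]
      tauto
  · refine h.not_good (Good.of_validAt (X := X) (H := edgesOff ends u \ F) (c := c) ?_ (fun w => ?_)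
      hF.oddAt_sdiff ?_)
    · rw [Finset.disjoint_left]
      intro x hx hx'
      simp only [hXdef, Finset.mem_union, Finset.mem_erase, mem_edgesAt,
        Finset.mem_sdiff, mem_edgesOff] at hx hx'
      tauto
    · by_cases hwu : w = u
      · rw [hwu]; exact validAt_of_pdeg hXu hcu
      · exact hc w hwu
    · refine (Finset.card_le_card (t := {e}) fun x => ?_).trans (Finset.card_singleton e).le
      simp only [hXdef, Finset.mem_union, Finset.mem_erase, mem_edgesAt,
        Finset.mem_sdiff, mem_edgesOff, Finset.mem_univ, Finset.mem_singleton]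
      tauto

/-- Two neighbors of odd degree of an even vertex are adjacent. -/
theorem IsBad.nbrs_adjacent (h : IsBad ends) {v u j : V}
    (hv : ∀ w, pdeg ends (edgesAt ends v) w = 0) (hu : u ∈ nbrs ends v) (hj : j ∈ nbrs ends v)
    (huj : u ≠ j) (hdu : pdeg ends Finset.univ u = 1) (hdj : pdeg ends Finset.univ j = 1) :
    j ∈ nbrs ends u := by
  by_contra hadj
  have hl := h.loopless
  have huv := ne_of_mem_nbrs hl hu
  have hjv := ne_of_mem_nbrs hl hj
  have hno : ∀ e, u ∈ ends e → j ∉ ends e := fun e h1 h2 =>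
    hadj (mem_nbrs.2 ⟨e, (Sym2.mem_and_mem_iff huj).1 ⟨h1, h2⟩⟩)
  by_cases hjoin : ∀ χ : V → ZMod 2,
      (∀ e ∈ edgesOff ends u \ edgesAt ends j, cob ends χ e = 0) →
      ∑ w, χ w * (pdeg ends (edgesOff ends u) w + (1 + if w = u then 1 else 0)) = 0
  · obtain ⟨F, hFS, hF, hFt⟩ := exists_join _ _ hjoin
    refine h.not_exists_isJoin_avoiding hv hu hj huj hadj hdu (F := F)
      ⟨fun e he => ?_, fun w hw => ?_⟩
      hF fun e he => ?_
    · exact (Finset.mem_sdiff.1 (hFS he)).1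
    · rw [hFt, if_neg hw, add_zero]
    · have := (Finset.mem_sdiff.1 (hFS he)).2
      rwa [mem_edgesAt] at this
  push Not at hjoin
  have hsub : edgesAt ends j ⊆ edgesOff ends u := fun e he => by
    rw [mem_edgesOff]; exact fun hue => hno e hue (mem_edgesAt.1 he)
  have hLeq : ∀ χ : V → ZMod 2, (∀ e ∈ edgesOff ends u \ edgesAt ends j, cob ends χ e = 0) →
      ∑ w, χ w * (pdeg ends (edgesOff ends u) w + (1 + if w = u then 1 else 0)) =
        ∑ w, χ w + ∑ e ∈ edgesAt ends j, cob ends χ e + χ u := by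
    intro χ hχ
    simp only [mul_add, Finset.sum_add_distrib, handshake, mul_one]
    rw [← Finset.sum_sdiff hsub, Finset.sum_eq_zero hχ]
    simp
    ring
  obtain ⟨d, ⟨hdu0, hdj0, hdv0, hd, hdsum⟩, hmin⟩ := exists_minimal_support (P := fun χ =>
    χ u = 0 ∧ χ j = 0 ∧ χ v = 0 ∧ (∀ e ∈ edgesOff ends u \ edgesAt ends j, cob ends χ e = 0) ∧
      ∑ w, χ w + ∑ e ∈ edgesAt ends j, cob ends χ e = 1) (by
    obtain ⟨χ, hχ, hsum⟩ := hjoin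
    have hsum := zmod_two_eq_one hsum
    rw [hLeq χ hχ] at hsum
    obtain ⟨χ, hχv, hχ, hsum⟩ : ∃ χ : V → ZMod 2, χ v = 0 ∧
        (∀ e ∈ edgesOff ends u \ edgesAt ends j, cob ends χ e = 0) ∧
        ∑ w, χ w + ∑ e ∈ edgesAt ends j, cob ends χ e + χ u = 1 := by
      rcases zmod_two_cases (χ v) with h1 | h1
      · exact ⟨χ, h1, hχ, hsum⟩
      · have hc1 : ∀ e, cob ends (χ + 1) e = cob ends χ e := fun e => by
          rw [cob_add]; exact (congrArg _ (cob_const_one hl e)).trans (add_zero _)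
        refine ⟨χ + 1, by simp [h1]; decide, fun e he => by rw [hc1, hχ e he], ?_⟩
        simp only [Finset.sum_congr rfl fun e _ => hc1 e, Pi.add_apply, Pi.one_apply,
          Finset.sum_add_distrib]
        rw [sum_one_eq, h.odd_order]
        linear_combination hsum + zmod_two_add_self 1
    have hcs : ∀ (p : V) (x : ZMod 2) (e : E), cob ends (Pi.single p x) e = x * inc ends e p := by
      intro p x e
      rw [cob, Finset.sum_eq_single p]
      · simp
      · intro b _ hb; simp [hb]
      · simp
    refine ⟨χ + Pi.single u (χ u) + Pi.single j (χ j), ?_, ?_, ?_, fun e he => ?_, ?_⟩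
    · simp [huj, zmod_two_add_self]
    · simp [huj.symm, zmod_two_add_self]
    · simp [huv.symm, hjv.symm, hχv]
    · have he' := he
      rw [Finset.mem_sdiff, mem_edgesOff, mem_edgesAt] at he'
      rw [cob_add, cob_add, hχ e he, hcs, hcs, inc_of_notMem he'.1, inc_of_notMem he'.2]
      simp
    · simp only [cob_add, Finset.sum_add_distrib, hcs, Pi.add_apply, ← Finset.mul_sum]
      have h1 : ∑ e ∈ edgesAt ends j, inc ends e u = 0 :=
        pdeg_eq_zero fun e he hue => hno e hue (mem_edgesAt.1 he)
      have h2 : ∑ e ∈ edgesAt ends j, inc ends e j = 1 := (pdeg_edgesAt_self j).trans hdj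
      rw [h1, h2]
      simp only [Finset.sum_pi_single', Finset.mem_univ, if_true]
      linear_combination hsum + zmod_two_add_self (χ j))
  have hd' : ∀ e, u ∉ ends e → j ∉ ends e → cob ends d e = 0 := fun e h1 h2 =>
    hd e (by simp [h1, h2])
  have hdM : ∀ w ∈ nbrs ends v, d w = 0 := by
    intro w hw
    by_cases hwu : w = u
    · rw [hwu, hdu0]
    by_cases hwj : w = j
    · rw [hwj, hdj0]
    obtain ⟨e, he⟩ := mem_nbrs.1 hw
    have := hd' e (by simp [he, huv, Ne.symm hwu]) (by simp [he, hjv, Ne.symm hwj])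
    rw [cob_eq hl _ he, hdv0, zero_add] at this
    exact this
  have huniq : ∀ x, x = u ∨ x = j → ∀ e₁ e₂, cob ends d e₁ = 1 → cob ends d e₂ = 1 →
      x ∈ ends e₁ → x ∈ ends e₂ → e₂ = e₁ := by
    intro x hx e₁ e₂ h₁ h₂ hx₁ hx₂
    by_contra hne
    have hdx : d x = 0 := by rcases hx with rfl | rfl <;> assumption
    have hxM : x ∈ nbrs ends v := by rcases hx with rfl | rfl <;> assumption
    obtain ⟨y₁, hy₁⟩ := hx₁
    obtain ⟨y₂, hy₂⟩ := hx₂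
    rw [cob_eq hl _ hy₁, hdx, zero_add] at h₁
    rw [cob_eq hl _ hy₂, hdx, zero_add] at h₂
    have hout : ∀ y, d y = 1 → y ∉ nbrs ends v ∧ y ≠ v := fun y hy =>
      ⟨fun hyM => by rw [hdM y hyM] at hy; exact zero_ne_one hy,
        fun hyv => by rw [hyv, hdv0] at hy; exact zero_ne_one hy⟩
    obtain ⟨χ, hχx, hχy, hχv, hχ⟩ := h.exists_cut hv hy₁ hxM (hout y₁ h₁).1 (hout y₁ h₁).2
    have hcl : ∀ e ∈ edgesOff ends u \ edgesAt ends j, cob ends (χ * d) e = 0 := by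
      intro e he
      have he' := he
      rw [Finset.mem_sdiff, mem_edgesOff, mem_edgesAt] at he'
      by_cases hve : v ∈ ends e
      · obtain ⟨w, hw⟩ := hve
        rw [cob_eq hl _ hw]
        simp [hdM w (mem_nbrs.2 ⟨e, hw⟩), hdv0]
      · refine cob_mul_eq_zero hl (hχ e hve ?_) (hd e he)
        rintro rfl
        have : x ∈ ends e := by simp [hy₁]
        rcases hx with rfl | rfl
        · exact he'.1 this
        · exact he'.2 this
    rcases zmod_two_cases (∑ w, (χ * d) w + ∑ e ∈ edgesAt ends j, cob ends (χ * d) e) with h0 | h0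
    · have h3 := hmin (d + χ * d) ⟨by simp [hdu0], by simp [hdj0], by simp [hdv0],
        fun e he => by rw [cob_add, hd e he, hcl e he, add_zero], by
          simp only [cob_add, Pi.add_apply, Finset.sum_add_distrib]
          linear_combination hdsum + h0⟩ fun w hw => by simp [hw]
      have h4 := congrFun h3 y₂
      have h5 := hχ e₂ (by simp [hy₂, (ne_of_mem_nbrs hl hxM).symm, (hout y₂ h₂).2.symm]) hne
      have h6 := (cob_eq_zero_iff hl hy₂).1 h5
      simp [h₂, ← h6, hχx] at h4
    · have h3 := hmin (χ * d) ⟨by simp [hdu0], by simp [hdj0], by simp [hdv0], hcl, h0⟩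
        fun w hw => by simp [hw]
      have h4 := congrFun h3 y₁
      simp [h₁, hχy] at h4
  have hnc : ∀ f, (∀ e, e ≠ f → cob ends d e = 0) → False := by
    intro f hf
    have h0 := no_bridge hl h.conn h.odd_order h.not_good d f hf
    have hall : ∀ e, cob ends d e = 0 := fun e => by
      by_cases hef : e = f
      · rw [hef, h0]
      · exact hf e hef
    have := h.conn d hall
    rw [Finset.sum_eq_zero fun w _ => (this w v).trans hdv0, Finset.sum_eq_zero fun e _ => hall e]
      at hdsum
    simp at hdsum
  have hex : ∀ x y, (x = u ∧ y = j ∨ x = j ∧ y = u) → ∃ e, cob ends d e = 1 ∧ x ∈ ends e := by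
    intro x y hxy
    by_contra! hcon
    have hoff : ∀ e, cob ends d e = 1 → y ∈ ends e := by
      intro e he
      by_contra hye
      rcases hxy with ⟨rfl, rfl⟩ | ⟨rfl, rfl⟩
      · rw [hd' e (hcon e he) hye] at he; exact zero_ne_one he
      · rw [hd' e hye (hcon e he)] at he; exact zero_ne_one he
    obtain ⟨f₀, -⟩ := mem_nbrs.1 hu
    by_cases hf : ∃ f, cob ends d f = 1
    · obtain ⟨f, hf⟩ := hf
      refine hnc f fun e hef => ?_
      refine (zmod_two_cases _).resolve_right fun he => hef ?_
      exact huniq y (by tauto) f e hf he (hoff f hf) (hoff e he)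
    · push Not at hf
      exact hnc f₀ fun e _ => (zmod_two_cases _).resolve_right (hf e)
  obtain ⟨f, hf, huf⟩ := hex u j (Or.inl ⟨rfl, rfl⟩)
  obtain ⟨f', hf', hjf'⟩ := hex j u (Or.inr ⟨rfl, rfl⟩)
  have hff : f' ≠ f := by rintro rfl; exact hno _ huf hjf'
  have hKj : ∑ e ∈ edgesAt ends j, cob ends d e = 1 := by
    rw [Finset.sum_eq_single f', hf']
    · intro e he hne
      refine (zmod_two_cases _).resolve_right fun he1 => hne ?_
      exact huniq j (Or.inr rfl) f' e hf' he1 hjf' (mem_edgesAt.1 he)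
    · exact fun h' => absurd (mem_edgesAt.2 hjf') h'
  refine h.not_good (good_of_two_cut hl h.conn h.odd_order hff hf' (χ := d) (fun e he he' => ?_) ?_)
  · refine (zmod_two_cases _).resolve_right fun he1 => ?_
    by_cases hue : u ∈ ends e
    · exact he (huniq u (Or.inl rfl) f e hf he1 huf hue)
    · by_cases hje : j ∈ ends e
      · exact he' (huniq j (Or.inr rfl) f' e hf' he1 hjf' hje)
      · rw [hd' e hue hje] at he1; exact zero_ne_one he1
  · rw [hKj] at hdsum
    linear_combination hdsum

theorem pdeg_eq_card_filter (S : Finset E) (u : V) :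
    pdeg ends S u = ((S.filter fun e => u ∈ ends e).card : ZMod 2) := by
  simp [pdeg, inc]

theorem pdeg_edgesAt_comm (a b : V) :
    pdeg ends (edgesAt ends a) b = pdeg ends (edgesAt ends b) a := by
  rw [pdeg_eq_card_filter, pdeg_eq_card_filter]
  congr 2
  ext e
  simp [and_comm]

theorem pdeg_edgesAt_eq_ncard {a b : V} (hab : a ≠ b) :
    pdeg ends (edgesAt ends a) b = ((bouquet ends a b).ncard : ZMod 2) := by
  rw [pdeg_eq_card_filter, ← Set.ncard_coe_finset]
  congr 2
  ext e
  simp [bouquet, Sym2.mem_and_mem_iff hab]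

theorem even_ncard_bouquet {a b : V} (hab : a ≠ b) (h : pdeg ends (edgesAt ends a) b = 0) :
    Even (bouquet ends a b).ncard := by
  rwa [pdeg_edgesAt_eq_ncard hab, ZMod.natCast_eq_zero_iff_even] at h

theorem odd_ncard_bouquet {a b : V} (hab : a ≠ b) (h : pdeg ends (edgesAt ends a) b = 1) :
    Odd (bouquet ends a b).ncard := by
  rwa [pdeg_edgesAt_eq_ncard hab, ZMod.natCast_eq_one_iff_odd] at h

theorem ncard_bouquet_pos {a b : V} (h : b ∈ nbrs ends a) : 0 < (bouquet ends a b).ncard := by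
  obtain ⟨e, he⟩ := mem_nbrs.1 h
  exact (Set.ncard_pos (Set.toFinite _)).2 ⟨e, he⟩

theorem IsBad.nbrs_nonempty (h : IsBad ends) (v : V) : (nbrs ends v).Nonempty := by
  by_contra hne
  rw [Finset.not_nonempty_iff_eq_empty] at hne
  have hV : ∀ w, w = v := fun w => by
    have := h.mem_of_closed {v} (Finset.mem_singleton_self v)
      (fun u hu w hw => by rw [Finset.mem_singleton.1 hu, hne] at hw; simp at hw) w
    simpa using this
  have hE : IsEmpty E := ⟨fun e => by
    obtain ⟨a, b, hab⟩ := exists_ends (ends := ends) e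
    exact ne_of_ends h.loopless hab ((hV a).trans (hV b).symm)⟩
  refine h.not_good ⟨∅, ∅, ∅, by simp, by simp, by simp, ?_, ?_, ?_, by simp⟩ <;>
  · intro u; left; simp

/-- An even vertex whose neighbors all have odd degree has at most two neighbors. -/
theorem IsBad.eq_or_eq_of_mem_nbrs (h : IsBad ends) {v : V} (hv : pdeg ends Finset.univ v = 0)
    (hodd : ∀ u ∈ nbrs ends v, pdeg ends Finset.univ u = 1) :
    ∃ a b, a ≠ b ∧ nbrs ends v = {a, b} := by
  have hl := h.loopless
  have hv' := pdeg_edgesAt_eq_zero hl h.conn h.odd_order h.not_good hv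
  obtain ⟨F, hF, hFf⟩ := exists_isJoin hl h.conn h.odd_order h.not_good v
  have hF0 : ∀ u ∈ nbrs ends v, pdeg ends F u = 0 := fun u hu => by
    have h1 := pdeg_edgesOff_add (ends := ends) v u
    rw [hv', add_zero, hodd u hu] at h1
    rw [hF.2 u (ne_of_mem_nbrs hl hu), h1, zmod_two_add_self]
  obtain ⟨hsum, hpar⟩ := hF.nbrs_parity hl h.not_good hv' hFf subset_rfl (by simp)
  have hFn : ∀ u ∈ nbrs ends v, ∀ e ∈ F, u ∉ ends e := fun u hu =>
    (hpar u hu).resolve_right fun h1 => by rw [hF0 u hu] at h1; exact zero_ne_one h1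
  have hcard : ((nbrs ends v).card : ZMod 2) = 0 := by
    rw [Finset.sum_congr rfl fun u hu => by rw [hF0 u hu, add_zero]] at hsum
    simpa using hsum
  rw [ZMod.natCast_eq_zero_iff_even] at hcard
  have hpos := (h.nbrs_nonempty v).card_pos
  by_cases h2 : (nbrs ends v).card = 2
  · exact Finset.card_eq_two.1 h2
  exfalso
  obtain ⟨a, b, c, ha, hb, hc, hab, hac, hbc⟩ := Finset.two_lt_card_iff.1
    (show 2 < (nbrs ends v).card by obtain ⟨k, hk⟩ := hcard; omega)
  have hadj : ∀ {x y}, x ∈ nbrs ends v → y ∈ nbrs ends v → x ≠ y → ∃ e, ends e = s(x, y) :=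
    fun hx hy hxy => mem_nbrs.1 (h.nbrs_adjacent hv' hx hy hxy (hodd _ hx) (hodd _ hy))
  obtain ⟨e₁, h₁⟩ := hadj ha hb hab
  obtain ⟨e₂, h₂⟩ := hadj hb hc hbc
  obtain ⟨e₃, h₃⟩ := hadj hc ha hac.symm
  have hb1 : e₁ ∉ F := fun h' => hFn a ha e₁ h' (by simp [h₁])
  have hb2 : e₂ ∉ F := fun h' => hFn b hb e₂ h' (by simp [h₂])
  have hb3 : e₃ ∉ F := fun h' => hFn a ha e₃ h' (by simp [h₃])
  have h12 : e₁ ≠ e₂ := by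
    rintro rfl
    have : a ∈ ends e₁ := by simp [h₁]
    simp [h₂, hab, hac] at this
  have h31 : e₃ ≠ e₁ := by
    rintro rfl
    have : b ∈ ends e₃ := by simp [h₁]
    simp [h₃, hab.symm, hbc] at this
  have h32 : e₃ ≠ e₂ := by
    rintro rfl
    have : b ∈ ends e₃ := by simp [h₂]
    simp [h₃, hab.symm, hbc] at this
  have hav := (ne_of_mem_nbrs hl ha).symm
  have hbv := (ne_of_mem_nbrs hl hb).symm
  have hcv := (ne_of_mem_nbrs hl hc).symm
  have hF' : Forest ends (insert e₁ (insert e₂ F)) := by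
    refine (hFf.insert_leaf hl (h₂.trans Sym2.eq_swap) (hFn c hc)).insert_leaf hl h₁ fun e he => ?_
    rcases Finset.mem_insert.1 he with rfl | he
    · simp [h₂, hab, hac]
    · exact hFn a ha e he
  have hJ : IsJoin ends v (insert e₃ (insert e₁ (insert e₂ F))) := by
    refine ⟨?_, fun u hu => ?_⟩
    · simp only [Finset.insert_subset_iff, mem_edgesOff, h₁, h₂, h₃, Sym2.mem_iff]
      refine ⟨?_, ?_, ?_, hF.1⟩ <;> tauto
    · rw [pdeg_insert (by simp [h31, h32, hb3]), pdeg_insert (by simp [h12, hb1]),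
        pdeg_insert hb2, ← hF.2 u hu]
      linear_combination inc_triangle hl h₁ h₂ h₃ u
  have := (hJ.nbrs_parity hl h.not_good hv' hF' (Finset.subset_insert _ _)
    (card_insert_sdiff_le _ _)).2 b hb
  rcases this with h' | h'
  · exact h' e₁ (by simp) (by simp [h₁])
  · rw [pdeg_insert (by simp [h12, hb1]), pdeg_insert hb2, hF0 b hb, inc_of_mem (by simp [h₁]),
      inc_of_mem (by simp [h₂])] at h'
    revert h'; decide

theorem IsBad.mem_of_nbrs_eq_pair (h : IsBad ends) {v a b : V}
    (hv : ∀ u, pdeg ends (edgesAt ends v) u = 0) (hM : nbrs ends v = {a, b})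
    (hab : b ∈ nbrs ends a) {y : V} (hy : y ∈ nbrs ends a) : y = v ∨ y = b := by
  by_contra! hne
  have hl := h.loopless
  obtain ⟨f, hf⟩ := mem_nbrs.1 hy
  obtain ⟨g, hg⟩ := mem_nbrs.1 hab
  have hya := ne_of_mem_nbrs hl hy
  have haM : a ∈ nbrs ends v := by simp [hM]
  have hbM : b ∈ nbrs ends v := by simp [hM]
  have hav := ne_of_mem_nbrs hl haM
  have hbv := ne_of_mem_nbrs hl hbM
  obtain ⟨χ, hχa, hχy, hχv, hχ⟩ := h.exists_cut hv hf haM (by simp [hM, hya, hne.2]) hne.1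
  have hgf : g ≠ f := by
    rintro rfl
    have : b ∈ ends g := by simp [hg]
    simp [hf, hne.2.symm, ne_of_mem_nbrs hl hab] at this
  have hχb : χ b = 1 := by
    rw [← (cob_eq_zero_iff hl hg).1 (hχ g (by simp [hg, hav.symm, hbv.symm]) hgf), hχa]
  have h0 := no_bridge hl h.conn h.odd_order h.not_good (Function.update χ v 1) f fun e he => by
    by_cases hve : v ∈ ends e
    · obtain ⟨w, hw⟩ := hve
      have hwM : w ∈ nbrs ends v := mem_nbrs.2 ⟨e, hw⟩
      have hwv := ne_of_mem_nbrs hl hwM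
      rw [cob_eq_zero_iff hl hw, Function.update_self, Function.update_of_ne hwv]
      rw [hM, Finset.mem_insert, Finset.mem_singleton] at hwM
      rcases hwM with rfl | rfl
      · exact hχa.symm
      · exact hχb.symm
    · rw [cob_update hl χ 1 hve, hχ e hve he]
  rw [cob_eq_zero_iff hl hf, Function.update_of_ne hav, Function.update_of_ne hne.1, hχa, hχy] at h0
  exact one_ne_zero h0

theorem IsBad.isShannon221 (h : IsBad ends) {v : V} (hv : pdeg ends Finset.univ v = 0)
    (hodd : ∀ u ∈ nbrs ends v, pdeg ends Finset.univ u = 1) : IsShannon221 ends := by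
  have hl := h.loopless
  have hv' := pdeg_edgesAt_eq_zero hl h.conn h.odd_order h.not_good hv
  obtain ⟨a, b, hab, hM⟩ := h.eq_or_eq_of_mem_nbrs hv hodd
  have haM : a ∈ nbrs ends v := by simp [hM]
  have hbM : b ∈ nbrs ends v := by simp [hM]
  have hav := ne_of_mem_nbrs hl haM
  have hbv := ne_of_mem_nbrs hl hbM
  have hadj := h.nbrs_adjacent hv' haM hbM hab (hodd a haM) (hodd b hbM)
  have hV : Finset.univ = {v, a, b} := by
    refine (Finset.eq_univ_of_forall fun w => h.mem_of_closed {v, a, b} (by simp : v ∈ _) ?_ w).symm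
    intro u hu w hw
    simp only [Finset.mem_insert, Finset.mem_singleton] at hu ⊢
    rcases hu with rfl | rfl | rfl
    · rw [hM] at hw; simp at hw; tauto
    · have := h.mem_of_nbrs_eq_pair hv' hM hadj hw; tauto
    · have := h.mem_of_nbrs_eq_pair hv' (hM.trans (Finset.pair_comm _ _))
        (mem_nbrs_comm.1 hadj) hw
      tauto
  have hodd_ab : pdeg ends (edgesAt ends a) b = 1 := by
    have h1 := handshake (ends := ends) (fun _ => 1) (edgesAt ends a)
    rw [Finset.sum_eq_zero fun e _ => cob_const_one hl e, hV,
      Finset.sum_insert (by simp [hav.symm, hbv.symm]), Finset.sum_insert (by simp [hab]),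
      Finset.sum_singleton, pdeg_edgesAt_self, hodd a haM, pdeg_edgesAt_comm, hv'] at h1
    linear_combination h1 - zmod_two_add_self 1
  refine ⟨?_, v, a, b, hav.symm, hbv.symm, hab, ncard_bouquet_pos haM,
    even_ncard_bouquet hav.symm (hv' a), ncard_bouquet_pos hbM,
    even_ncard_bouquet hbv.symm (hv' b), odd_ncard_bouquet hab hodd_ab⟩
  rw [← Finset.card_univ, hV]
  exact Finset.card_eq_three.2 ⟨v, a, b, hav.symm, hbv.symm, hab, rfl⟩

theorem IsBad.exists_even (h : IsBad ends) : ∃ v, pdeg ends Finset.univ v = 0 := by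
  by_contra! hne
  have h1 := handshake (ends := ends) (fun _ => 1) Finset.univ
  rw [Finset.sum_eq_zero fun e _ => cob_const_one h.loopless e,
    Finset.sum_congr rfl fun u _ => by rw [one_mul, zmod_two_eq_one (hne u)], sum_one_eq,
    h.odd_order] at h1
  exact one_ne_zero h1

theorem IsBad.isShannon (h : IsBad ends) : IsShannon222 ends ∨ IsShannon221 ends := by
  obtain ⟨v, hv⟩ := h.exists_even
  by_cases hw : ∃ w ∈ nbrs ends v, pdeg ends Finset.univ w = 0
  · obtain ⟨w, hwM, hw⟩ := hw
    obtain ⟨hcard, hall⟩ := h.even_neighbor hv hw hwM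
    exact Or.inl ⟨hcard, fun u w huw => ⟨ncard_bouquet_pos (hall u w huw).1,
      even_ncard_bouquet huw (hall u w huw).2⟩⟩
  · push Not at hw
    exact Or.inr (h.isShannon221 hv fun u hu => zmod_two_eq_one (hw u hu))

theorem conn_of_reflTransGen (hl : ∀ e, ¬ (ends e).IsDiag)
    (hconn : ∀ u v : V, Relation.ReflTransGen (fun a b => ∃ e, ends e = s(a, b)) u v) :
    Conn ends := by
  intro χ hχ u w
  induction hconn u w with
  | refl => rfl
  | tail _ hstep ih =>
    obtain ⟨e, he⟩ := hstep
    exact ih.trans ((cob_eq_zero_iff hl he).1 (hχ e))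

theorem good_of_not_shannon (hl : ∀ e, ¬ (ends e).IsDiag) (hconn : Conn ends)
    (h222 : ¬ IsShannon222 ends) (h221 : ¬ IsShannon221 ends) : Good ends := by
  rcases zmod_two_cases (Fintype.card V : ZMod 2) with hn | hn
  · exact good_of_even hl hconn hn
  · by_contra hgood
    exact (IsBad.isShannon ⟨hl, hconn, hn, hgood⟩).elim h222 h221

theorem OddAt.ncard {X : Finset E} {u : V} (hX : OddAt ends X u) {P : E → Prop}
    (hP : ∀ e, P e ↔ e ∈ X) :
    {e | P e ∧ u ∈ ends e}.ncard = 0 ∨ Odd {e | P e ∧ u ∈ ends e}.ncard := by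
  have hset : {e | P e ∧ u ∈ ends e} = ↑(X.filter fun e => u ∈ ends e) := by
    ext e; simp [hP]
  rw [hset, Set.ncard_coe_finset]
  rcases hX with h | h
  · left; rw [Finset.card_eq_zero, Finset.filter_eq_empty_iff]; exact h
  · right; rwa [pdeg_eq_card_filter, ZMod.natCast_eq_one_iff_odd] at h

theorem Good.exists_coloring (h : Good ends) :
    (∃ φ : E → Fin 3, ∀ (u : V) (j : Fin 3),
      {e | φ e = j ∧ u ∈ ends e}.ncard = 0 ∨ Odd {e | φ e = j ∧ u ∈ ends e}.ncard) ∨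
    (∃ φ : E → Fin 4,
      (∀ (u : V) (j : Fin 4),
        {e | φ e = j ∧ u ∈ ends e}.ncard = 0 ∨ Odd {e | φ e = j ∧ u ∈ ends e}.ncard) ∧
      ∃ j : Fin 4, {e | φ e = j}.ncard = 1) := by
  obtain ⟨A, B, C, hAB, hAC, hBC, hA, hB, hC, hcard⟩ := h
  rw [Finset.disjoint_left] at hAB hAC hBC
  rcases Nat.le_one_iff_eq_zero_or_eq_one.1 hcard with h0 | h1
  · left
    have hall : ∀ e, e ∈ A ∨ e ∈ B ∨ e ∈ C := fun e => by
      have : e ∉ Finset.univ \ (A ∪ B ∪ C) := by rw [Finset.card_eq_zero.1 h0]; simp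
      simp at this; tauto
    refine ⟨fun e => if e ∈ A then 0 else if e ∈ B then 1 else 2, fun u j => ?_⟩
    fin_cases j
    · refine (hA u).ncard fun e => ?_
      by_cases hA' : e ∈ A <;> by_cases hB' : e ∈ B <;> simp [hA', hB']
    · refine (hB u).ncard fun e => ?_
      have := @hAB e
      by_cases hA' : e ∈ A <;> by_cases hB' : e ∈ B <;> simp_all
    · refine (hC u).ncard fun e => ?_
      have := @hAC e
      have := @hBC e
      have := hall e
      by_cases hA' : e ∈ A <;> by_cases hB' : e ∈ B <;> simp_all
  · right
    obtain ⟨g, hg⟩ := Finset.card_eq_one.1 h1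
    have hall : ∀ e, e = g ↔ e ∉ A ∧ e ∉ B ∧ e ∉ C := fun e => by
      rw [← Finset.mem_singleton, ← hg]; simp [not_or]
    have hD : ∀ e,
        (if e ∈ A then (0 : Fin 4) else if e ∈ B then 1 else if e ∈ C then 2 else 3) = 3 ↔
        e = g := fun e => by
      rw [hall]; split_ifs <;> simp_all
    refine ⟨fun e => if e ∈ A then 0 else if e ∈ B then 1 else if e ∈ C then 2 else 3,
      fun u j => ?_, 3, ?_⟩
    · fin_cases j
      · refine (hA u).ncard fun e => ?_
        dsimp only
        split_ifs <;> simp_all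
      · refine (hB u).ncard fun e => ?_
        have := @hAB e
        dsimp only
        split_ifs <;> simp_all
      · refine (hC u).ncard fun e => ?_
        have := @hAC e
        have := @hBC e
        dsimp only
        split_ifs <;> simp_all
      · refine OddAt.ncard (X := {g}) ?_ fun e => (hD e).trans Finset.mem_singleton.symm
        by_cases hu : u ∈ ends g
        · right; rw [pdeg_singleton, inc_of_mem hu]
        · left; simpa using hu
    · simp only [hD]
      exact Set.ncard_singleton g

end

end OddColoring

/-- For any connected loopless multigraph `G` that is not a Shannon triangle of type
(2,2,2) or (2,2,1), either `G` admits an odd 3-edge-coloring, or `G` admits an odd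
4-edge-coloring in which one of the colors is used on exactly one edge. -/
theorem stmt_11 {V E : Type*} [Fintype V] [Fintype E] [Nonempty V]
    (ends : E → Sym2 V)
    (hloopless : ∀ e, ¬ (ends e).IsDiag)
    (hconn : ∀ u v : V,
      Relation.ReflTransGen (fun a b => ∃ e, ends e = s(a, b)) u v)
    (h222 : ¬ IsShannon222 ends) (h221 : ¬ IsShannon221 ends) :
    (∃ φ : E → Fin 3, ∀ (u : V) (j : Fin 3),
      {e | φ e = j ∧ u ∈ ends e}.ncard = 0 ∨
        Odd {e | φ e = j ∧ u ∈ ends e}.ncard) ∨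
    (∃ φ : E → Fin 4,
      (∀ (u : V) (j : Fin 4),
        {e | φ e = j ∧ u ∈ ends e}.ncard = 0 ∨
          Odd {e | φ e = j ∧ u ∈ ends e}.ncard) ∧
      ∃ j : Fin 4, {e | φ e = j}.ncard = 1) := by
  classical
  exact (OddColoring.good_of_not_shannon hloopless
    (OddColoring.conn_of_reflTransGen hloopless hconn) h222 h221).exists_coloring
end
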